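/- arXiv:2510.16006 — 3 statements merged into one kernel-verified Lean document; each statement's English description precedes it below -/
import Mathlib

section
/- The map R ↦ μ({x ∈ X : ρ(C(x,n,R), Id) < 1/m}) is lower semicontinuous on Ext(S); consequently its superlevel set {R : μ({x : ρ(C(x,n,R), Id) < 1/m}) > 0} is open. -/
open MeasureTheory Set

/-- A measure-preserving automorphism of `(X, μ)`. -/
structure Aut (X : Type*) [MeasurableSpace X] (μ : Measure X) where
  toEquiv : X ≃ᵐ X
  mp : MeasurePreserving toEquiv μ μ

namespace Aut

variable {X : Type*} [MeasurableSpace X] {μ : Measure X}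

/-- The identity automorphism. -/
def id (μ : Measure X) : Aut X μ := ⟨MeasurableEquiv.refl X, MeasurePreserving.id μ⟩

/-- Composition of automorphisms: `(a.comp b) x = a (b x)`. -/
def comp (a b : Aut X μ) : Aut X μ :=
  ⟨b.toEquiv.trans a.toEquiv, a.mp.comp b.mp⟩

/-- Inverse automorphism. -/
def inv (a : Aut X μ) : Aut X μ := ⟨a.toEquiv.symm, a.mp.symm a.toEquiv⟩

end Aut

/-- The Halmos (pseudo)metric on `Aut X μ` associated with a fixed family `A`
of measurable sets (dense in the measure algebra):
`ρ(S,T) = Σ_i 2^{-i} (μ(S A_i Δ T A_i) + μ(S⁻¹ A_i Δ T⁻¹ A_i))`. -/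
noncomputable def halmos {X : Type*} [MeasurableSpace X] {μ : Measure X}
    (A : ℕ → Set X) (S T : Aut X μ) : ℝ :=
  ∑' i : ℕ, (1 / 2 : ℝ) ^ i *
    ((μ (symmDiff (S.toEquiv '' A i) (T.toEquiv '' A i))).toReal +
     (μ (symmDiff (S.toEquiv.symm '' A i) (T.toEquiv.symm '' A i))).toReal)

/-- A skew product over `S`: an automorphism `R` of the product space together with
a measurable family of fiber automorphisms `T x` such that `R(x,y) = (Sx, T_x y)`. -/
structure SkewExt {X : Type*} [MeasurableSpace X] {μ : Measure X} (S : Aut X μ) where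
  T : X → Aut X μ
  prod : Aut (X × X) (μ.prod μ)
  spec : ∀ p : X × X, prod.toEquiv p = (S.toEquiv p.1, (T p.1).toEquiv p.2)

/-- `R ∈ Ext(S)`: `R` is a skew product over `S` for some measurable family of fibers. -/
def IsSkewProduct {X : Type*} [MeasurableSpace X] {μ : Measure X}
    (S : Aut X μ) (R : Aut (X × X) (μ.prod μ)) : Prop :=
  ∃ T : X → Aut X μ, ∀ p : X × X, R.toEquiv p = (S.toEquiv p.1, (T p.1).toEquiv p.2)

/-- The `n`-step cocycle `C(x,n,R) = T_{S^{n-1}x} ∘ ⋯ ∘ T_{Sx} ∘ T_x`. -/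
noncomputable def cocycle {X : Type*} [MeasurableSpace X] {μ : Measure X}
    (S : Aut X μ) (T : X → Aut X μ) (x : X) : ℕ → Aut X μ
  | 0 => Aut.id μ
  | n + 1 => (T (S.toEquiv^[n] x)).comp (cocycle S T x n)

/-- Openness of a set with respect to a (pseudo)metric `d`. -/
def IsOpenWrt {Z : Type*} (d : Z → Z → ℝ) (U : Set Z) : Prop :=
  ∀ z ∈ U, ∃ ε > (0 : ℝ), ∀ w, d z w < ε → w ∈ U

/-- `D` is a `G_δ` set with respect to the (pseudo)metric `d`. -/
def IsGdeltaWrt {Z : Type*} (d : Z → Z → ℝ) (D : Set Z) : Prop :=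
  ∃ U : ℕ → Set Z, (∀ k, IsOpenWrt d (U k)) ∧ D = ⋂ k, U k

/-- `D` is dense with respect to the (pseudo)metric `d`. -/
def IsDenseWrt {Z : Type*} (d : Z → Z → ℝ) (D : Set Z) : Prop :=
  ∀ z : Z, ∀ ε > (0 : ℝ), ∃ w ∈ D, d z w < ε

/-- `S` is aperiodic: for every `n ≥ 1` the set of `n`-periodic points is null. -/
def Aperiodic {X : Type*} [MeasurableSpace X] {μ : Measure X} (S : Aut X μ) : Prop :=
  ∀ n : ℕ, 1 ≤ n → μ {x : X | S.toEquiv^[n] x = x} = 0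

/-- The trivial extension `S × Id`. -/
def prodId {X : Type*} [MeasurableSpace X] {μ : Measure X} [SFinite μ] (S : Aut X μ) :
    Aut (X × X) (μ.prod μ) :=
  ⟨S.toEquiv.prodCongr (MeasurableEquiv.refl X), S.mp.prod (MeasurePreserving.id μ)⟩

/-- Membership in `𝒥`: automorphisms of the product leaving every `A × X` invariant. -/
def MemJ {X : Type*} [MeasurableSpace X] {μ : Measure X}
    (J : Aut (X × X) (μ.prod μ)) : Prop :=
  ∀ A : Set X, MeasurableSet A → J.toEquiv '' (A ×ˢ (univ : Set X)) = A ×ˢ (univ : Set X)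


section Helpers
open Filter Topology

variable {X : Type*} [MeasurableSpace X] {μ : Measure X}

lemma real_symmDiff_tri {Y : Type*} [MeasurableSpace Y] (ν : Measure Y) [IsFiniteMeasure ν]
    (a b c : Set Y) :
    ν.real (symmDiff a c) ≤ ν.real (symmDiff a b) + ν.real (symmDiff b c) :=
  (measureReal_mono (symmDiff_triangle a b c)).trans (measureReal_union_le _ _)

lemma summable_w {Y : Type*} [MeasurableSpace Y] (ν : Measure Y) [IsProbabilityMeasure ν]
    (s : ℕ → Set Y) : Summable (fun i : ℕ => (1 / 2 : ℝ) ^ i * (2 * ν.real (s i))) := by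
  refine Summable.of_nonneg_of_le (fun i => by positivity) (fun i => ?_)
    ((summable_geometric_two).mul_right 2)
  have : ν.real (s i) ≤ 1 := measureReal_le_one
  gcongr
  linarith

lemma halmos_id_eq (A : ℕ → Set X) (hAm : ∀ i, MeasurableSet (A i)) (T : Aut X μ) :
    halmos A T (Aut.id μ) =
      ∑' i : ℕ, (1 / 2 : ℝ) ^ i * (2 * μ.real (symmDiff (T.toEquiv ⁻¹' A i) (A i))) := by
  unfold halmos
  refine tsum_congr fun i => ?_
  have h1 : (Aut.id μ).toEquiv '' A i = A i := by simp [Aut.id]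
  have h2 : (Aut.id μ).toEquiv.symm '' A i = A i := by simp [Aut.id]
  have h3 : T.toEquiv.symm '' A i = T.toEquiv ⁻¹' A i := by
    rw [MeasurableEquiv.image_eq_preimage_symm]; rfl
  have h4 : μ (symmDiff (T.toEquiv '' A i) (A i)) = μ (symmDiff (T.toEquiv ⁻¹' A i) (A i)) := by
    have hm : MeasurableSet (symmDiff (T.toEquiv '' A i) (A i)) :=
      (T.toEquiv.measurableSet_image.2 (hAm i)).symmDiff (hAm i)
    rw [← T.mp.measure_preimage hm.nullMeasurableSet, preimage_symmDiff,
      preimage_image_eq _ T.toEquiv.injective, symmDiff_comm]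
  rw [h1, h2, h3, h4, Measure.real]
  ring

lemma iterate_prod {S : Aut X μ} (E : SkewExt S) (n : ℕ) (x y : X) :
    E.prod.toEquiv^[n] (x, y) = (S.toEquiv^[n] x, (cocycle S E.T x n).toEquiv y) := by
  induction n with
  | zero => rfl
  | succ k ih =>
    rw [Function.iterate_succ_apply', ih, E.spec, Function.iterate_succ_apply']
    rfl

lemma section_eq {S : Aut X μ} (E : SkewExt S) (n : ℕ) (x : X) (B : Set X) :
    (cocycle S E.T x n).toEquiv ⁻¹' B =
      Prod.mk x ⁻¹' (E.prod.toEquiv^[n] ⁻¹' (univ ×ˢ B)) := by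
  ext y
  simp [iterate_prod]

lemma halmos_term_le {Y : Type*} [MeasurableSpace Y] {ν : Measure Y} [IsProbabilityMeasure ν]
    (A : ℕ → Set Y) (S T : Aut Y ν) (i : ℕ) :
    ν.real (symmDiff (S.toEquiv ⁻¹' A i) (T.toEquiv ⁻¹' A i)) ≤ 2 ^ i * halmos A S T := by
  have h3 : ∀ T : Aut Y ν, T.toEquiv ⁻¹' A i = T.toEquiv.symm '' A i := by
    intro T
    rw [MeasurableEquiv.image_eq_preimage_symm]; rfl
  have hs : Summable (fun i : ℕ => (1 / 2 : ℝ) ^ i *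
    ((ν (symmDiff (S.toEquiv '' A i) (T.toEquiv '' A i))).toReal +
     (ν (symmDiff (S.toEquiv.symm '' A i) (T.toEquiv.symm '' A i))).toReal)) := by
    refine Summable.of_nonneg_of_le (fun i => by positivity) (fun i => ?_)
      ((summable_geometric_two).mul_right 2)
    have h1 : ν.real (symmDiff (S.toEquiv '' A i) (T.toEquiv '' A i)) ≤ 1 := measureReal_le_one
    have h2 : ν.real (symmDiff (S.toEquiv.symm '' A i) (T.toEquiv.symm '' A i)) ≤ 1 :=
      measureReal_le_one
    simp only [Measure.real] at h1 h2
    gcongr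
    linarith
  have hle := hs.le_tsum i (fun j _ => by positivity)
  rw [h3 S, h3 T]
  have hp : (2 : ℝ) ^ i * (1 / 2) ^ i = 1 := by rw [← mul_pow]; norm_num
  calc ν.real _ ≤ (ν (symmDiff (S.toEquiv '' A i) (T.toEquiv '' A i))).toReal +
     (ν (symmDiff (S.toEquiv.symm '' A i) (T.toEquiv.symm '' A i))).toReal := by
        simp only [Measure.real]
        exact le_add_of_nonneg_left ENNReal.toReal_nonneg
    _ = 2 ^ i * ((1 / 2 : ℝ) ^ i * ((ν (symmDiff (S.toEquiv '' A i) (T.toEquiv '' A i))).toReal +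
     (ν (symmDiff (S.toEquiv.symm '' A i) (T.toEquiv.symm '' A i))).toReal)) := by
        rw [← mul_assoc, hp, one_mul]
    _ ≤ _ := by unfold halmos; gcongr

lemma tendsto_one {Y ι : Type*} [MeasurableSpace Y] {ν : Measure Y} [IsProbabilityMeasure ν]
    (A : ℕ → Set Y) (hAm : ∀ i, MeasurableSet (A i))
    (hAd : ∀ B : Set Y, MeasurableSet B → ∀ ε > (0 : ℝ),
      ∃ i, ν (symmDiff B (A i)) < ENNReal.ofReal ε)
    (S : Aut Y ν) (T : ι → Aut Y ν) (l : Filter ι)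
    (hl : Tendsto (fun j => halmos A S (T j)) l (𝓝 0)) (B : Set Y) (hB : MeasurableSet B) :
    Tendsto (fun j => ν.real (symmDiff (S.toEquiv ⁻¹' B) ((T j).toEquiv ⁻¹' B))) l (𝓝 0) := by
  rw [Metric.tendsto_nhds]
  intro ε hε
  obtain ⟨i, hi⟩ := hAd B hB (ε / 3) (by positivity)
  have hi' : ν.real (symmDiff B (A i)) < ε / 3 := by
    rw [Measure.real]
    exact (ENNReal.lt_ofReal_iff_toReal_lt (measure_ne_top _ _)).1 hi
  have hpre : ∀ T : Aut Y ν, ν.real (symmDiff (T.toEquiv ⁻¹' B) (T.toEquiv ⁻¹' A i)) < ε / 3 := by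
    intro T
    rw [← preimage_symmDiff, Measure.real,
      T.mp.measure_preimage (hB.symmDiff (hAm i)).nullMeasurableSet]
    exact hi'
  have h2 : Tendsto (fun j => 2 ^ i * halmos A S (T j)) l (𝓝 0) := by
    simpa using hl.const_mul (2 ^ i)
  filter_upwards [h2.eventually (gt_mem_nhds (show (0 : ℝ) < ε / 3 by positivity))] with j hj
  rw [Real.dist_eq, sub_zero, abs_of_nonneg measureReal_nonneg]
  have a1 := real_symmDiff_tri ν (S.toEquiv ⁻¹' B) (S.toEquiv ⁻¹' A i) ((T j).toEquiv ⁻¹' B)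
  have a2 := real_symmDiff_tri ν (S.toEquiv ⁻¹' A i) ((T j).toEquiv ⁻¹' A i) ((T j).toEquiv ⁻¹' B)
  have a3 := halmos_term_le A S (T j) i
  have a4 := hpre (T j)
  rw [symmDiff_comm] at a4
  linarith [hpre S]

lemma tendsto_iter {Y ι : Type*} [MeasurableSpace Y] {ν : Measure Y} [IsProbabilityMeasure ν]
    (A : ℕ → Set Y) (hAm : ∀ i, MeasurableSet (A i))
    (hAd : ∀ B : Set Y, MeasurableSet B → ∀ ε > (0 : ℝ),
      ∃ i, ν (symmDiff B (A i)) < ENNReal.ofReal ε)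
    (S : Aut Y ν) (T : ι → Aut Y ν) (l : Filter ι)
    (hl : Tendsto (fun j => halmos A S (T j)) l (𝓝 0)) (n : ℕ) (B : Set Y)
    (hB : MeasurableSet B) :
    Tendsto (fun j => ν.real (symmDiff (S.toEquiv^[n] ⁻¹' B) ((T j).toEquiv^[n] ⁻¹' B)))
      l (𝓝 0) := by
  induction n generalizing B with
  | zero => simpa using tendsto_const_nhds
  | succ k ih =>
    have h1 := ih (S.toEquiv ⁻¹' B) (S.toEquiv.measurable hB)
    have h2 := tendsto_one A hAm hAd S T l hl B hB
    have h3 := h1.add h2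
    rw [add_zero] at h3
    refine squeeze_zero (fun _ => measureReal_nonneg) (fun j => ?_) h3
    rw [Function.iterate_succ', Function.iterate_succ', preimage_comp, preimage_comp]
    refine (real_symmDiff_tri ν _ ((T j).toEquiv^[k] ⁻¹' (S.toEquiv ⁻¹' B)) _).trans ?_
    refine add_le_add le_rfl (le_of_eq ?_)
    rw [← preimage_symmDiff, Measure.real, Measure.real,
      ((T j).mp.iterate k).measure_preimage
      ((S.toEquiv.measurable hB).symmDiff ((T j).toEquiv.measurable hB)).nullMeasurableSet]

/-- The averaged distance between the `n`-step cocycles. -/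
noncomputable def devSet {S : Aut X μ} (A : ℕ → Set X) (n : ℕ) (E F : SkewExt S) (i : ℕ) :
    Set (X × X) :=
  symmDiff (E.prod.toEquiv^[n] ⁻¹' (univ ×ˢ A i)) (F.prod.toEquiv^[n] ⁻¹' (univ ×ˢ A i))

/-- The pointwise distance between the `n`-step cocycles. -/
noncomputable def dev {S : Aut X μ} (A : ℕ → Set X) (n : ℕ) (E F : SkewExt S) (x : X) : ℝ :=
  ∑' i : ℕ, (1 / 2 : ℝ) ^ i * (2 * μ.real (Prod.mk x ⁻¹' devSet A n E F i))

lemma halmos_le_dev [IsProbabilityMeasure μ] {S : Aut X μ} (A : ℕ → Set X)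
    (hAm : ∀ i, MeasurableSet (A i)) (n : ℕ) (E F : SkewExt S) (x : X) :
    halmos A (cocycle S F.T x n) (Aut.id μ) ≤
      halmos A (cocycle S E.T x n) (Aut.id μ) + dev A n E F x := by
  rw [halmos_id_eq A hAm, halmos_id_eq A hAm, dev,
    ← (summable_w μ _).tsum_add (summable_w μ _)]
  refine (summable_w μ _).tsum_le_tsum (fun i => ?_) ((summable_w μ _).add (summable_w μ _))
  rw [devSet, preimage_symmDiff, ← section_eq, ← section_eq, ← mul_add, ← mul_add]
  gcongr
  rw [add_comm, symmDiff_comm ((cocycle S E.T x n).toEquiv ⁻¹' A i)]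
  refine (real_symmDiff_tri μ _ ((cocycle S E.T x n).toEquiv ⁻¹' A i) _)

lemma measurableSet_devSet {S : Aut X μ} (A : ℕ → Set X)
    (hAm : ∀ i, MeasurableSet (A i)) (n : ℕ) (E F : SkewExt S) (i : ℕ) :
    MeasurableSet (devSet A n E F i) :=
  ((E.prod.toEquiv.measurable.iterate n) (MeasurableSet.univ.prod (hAm i))).symmDiff
    ((F.prod.toEquiv.measurable.iterate n) (MeasurableSet.univ.prod (hAm i)))

lemma ofReal_w {Y : Type*} [MeasurableSpace Y] (ν : Measure Y) [IsProbabilityMeasure ν]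
    (s : ℕ → Set Y) : ENNReal.ofReal (∑' i : ℕ, (1 / 2 : ℝ) ^ i * (2 * ν.real (s i))) =
      ∑' i : ℕ, ENNReal.ofReal ((1 / 2 : ℝ) ^ i * 2) * ν (s i) := by
  rw [ENNReal.ofReal_tsum_of_nonneg (fun i => by positivity) (summable_w ν s)]
  refine tsum_congr fun i => ?_
  rw [← mul_assoc, ENNReal.ofReal_mul (by positivity), ofReal_measureReal]

lemma markov_dev [IsProbabilityMeasure μ] {S : Aut X μ} (A : ℕ → Set X)
    (hAm : ∀ i, MeasurableSet (A i)) (n : ℕ) (E F : SkewExt S) (δ : ℝ) (hδ : 0 < δ) :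
    δ * μ.real {x | δ ≤ dev A n E F x} ≤
      ∑' i : ℕ, (1 / 2 : ℝ) ^ i * (2 * (μ.prod μ).real (devSet A n E F i)) := by
  have hmeas : ∀ i, Measurable fun x => ENNReal.ofReal ((1 / 2 : ℝ) ^ i * 2) *
      μ (Prod.mk x ⁻¹' devSet A n E F i) := fun i =>
    (measurable_measure_prodMk_left (measurableSet_devSet A hAm n E F i)).const_mul _
  have h1 : ∫⁻ x, ENNReal.ofReal (dev A n E F x) ∂μ = ENNReal.ofReal
      (∑' i : ℕ, (1 / 2 : ℝ) ^ i * (2 * (μ.prod μ).real (devSet A n E F i))) := by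
    simp only [dev, ofReal_w]
    rw [lintegral_tsum fun i => (hmeas i).aemeasurable]
    refine tsum_congr fun i => ?_
    rw [lintegral_const_mul _
      (measurable_measure_prodMk_left (measurableSet_devSet A hAm n E F i)),
      Measure.prod_apply (measurableSet_devSet A hAm n E F i)]
  have hm : Measurable fun x => ENNReal.ofReal (dev A n E F x) := by
    simp only [dev, ofReal_w]
    exact Measurable.ennreal_tsum hmeas
  have h2 := mul_meas_ge_le_lintegral (μ := μ) hm (ENNReal.ofReal δ)
  rw [h1] at h2
  have hset : {x | ENNReal.ofReal δ ≤ ENNReal.ofReal (dev A n E F x)} =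
      {x | δ ≤ dev A n E F x} := by
    ext x
    exact ENNReal.ofReal_le_ofReal_iff (tsum_nonneg fun i => by positivity)
  rw [hset, ← ofReal_measureReal, ← ENNReal.ofReal_mul hδ.le,
    ENNReal.ofReal_le_ofReal_iff (tsum_nonneg fun i => by positivity)] at h2
  exact h2

lemma tendsto_avg [IsProbabilityMeasure μ] {S : Aut X μ} (A : ℕ → Set X)
    (hAm : ∀ i, MeasurableSet (A i))
    (A₂ : ℕ → Set (X × X)) (hA₂m : ∀ i, MeasurableSet (A₂ i))
    (hA₂d : ∀ B : Set (X × X), MeasurableSet B → ∀ ε > (0 : ℝ),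
      ∃ i, (μ.prod μ) (symmDiff B (A₂ i)) < ENNReal.ofReal ε)
    (n : ℕ) (E : SkewExt S) (l : Filter (SkewExt S))
    (hl : Tendsto (fun F : SkewExt S => halmos A₂ E.prod F.prod) l (𝓝 0)) :
    Tendsto (fun F => ∑' i : ℕ, (1 / 2 : ℝ) ^ i * (2 * (μ.prod μ).real (devSet A n E F i)))
      l (𝓝 0) := by
  have h := tendsto_tsum_of_dominated_convergence (𝓕 := l) (g := fun _ : ℕ => (0 : ℝ))
    (f := fun F i => (1 / 2 : ℝ) ^ i * (2 * (μ.prod μ).real (devSet A n E F i)))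
    (bound := fun i => (1 / 2 : ℝ) ^ i * 2)
    ((summable_geometric_two).mul_right 2) ?_ ?_
  · simpa using h
  · intro i
    have := tendsto_iter A₂ hA₂m hA₂d E.prod (fun F : SkewExt S => F.prod) l hl n
      (univ ×ˢ A i) (MeasurableSet.univ.prod (hAm i))
    simpa [devSet] using (this.const_mul 2).const_mul ((1 / 2 : ℝ) ^ i)
  · refine Eventually.of_forall fun F i => ?_
    have h1 : (μ.prod μ).real (devSet A n E F i) ≤ 1 := measureReal_le_one
    rw [Real.norm_of_nonneg (by positivity)]
    gcongr
    linarith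

lemma lsc_aux [IsProbabilityMeasure μ] {S : Aut X μ} (A : ℕ → Set X)
    (hAm : ∀ i, MeasurableSet (A i))
    (A₂ : ℕ → Set (X × X)) (hA₂m : ∀ i, MeasurableSet (A₂ i))
    (hA₂d : ∀ B : Set (X × X), MeasurableSet B → ∀ ε > (0 : ℝ),
      ∃ i, (μ.prod μ) (symmDiff B (A₂ i)) < ENNReal.ofReal ε)
    (r : ℝ) (n : ℕ) (E : SkewExt S) (c : ℝ)
    (hc : c < (μ {x : X | halmos A (cocycle S E.T x n) (Aut.id μ) < r}).toReal) :
    ∃ ε > (0 : ℝ), ∀ F : SkewExt S, halmos A₂ E.prod F.prod < ε →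
      c < (μ {x : X | halmos A (cocycle S F.T x n) (Aut.id μ) < r}).toReal := by
  set f : SkewExt S → X → ℝ := fun F x => halmos A (cocycle S F.T x n) (Aut.id μ) with hf
  have hU : {x | f E x < r} = ⋃ k : ℕ, {x | f E x < r - 1 / ((k : ℝ) + 1)} := by
    ext x
    simp only [mem_setOf_eq, mem_iUnion]
    constructor
    · intro h
      obtain ⟨k, hk⟩ := exists_nat_one_div_lt (sub_pos.2 h)
      exact ⟨k, by linarith⟩
    · rintro ⟨k, hk⟩
      have : 0 < 1 / ((k : ℝ) + 1) := by positivity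
      linarith
  have hmono : Monotone fun k : ℕ => {x | f E x < r - 1 / ((k : ℝ) + 1)} := by
    intro a b hab x hx
    simp only [mem_setOf_eq] at hx ⊢
    have : 1 / ((b : ℝ) + 1) ≤ 1 / ((a : ℝ) + 1) := Nat.one_div_le_one_div hab
    linarith
  have ht := tendsto_measure_iUnion_atTop (μ := μ) hmono
  rw [← hU] at ht
  have ht' := (ENNReal.tendsto_toReal (measure_ne_top μ _)).comp ht
  obtain ⟨k, hk⟩ := (ht'.eventually (lt_mem_nhds hc)).exists
  set δ : ℝ := 1 / ((k : ℝ) + 1) with hδdef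
  have hδ : 0 < δ := by positivity
  change c < μ.real {x | f E x < r - δ} at hk
  set η := μ.real {x | f E x < r - δ} - c with hη
  have hη0 : 0 < η := sub_pos.2 hk
  have hav := tendsto_avg A hAm A₂ hA₂m hA₂d n E
    (comap (fun F : SkewExt S => halmos A₂ E.prod F.prod) (𝓝 0)) tendsto_comap
  have hev := hav.eventually (gt_mem_nhds (mul_pos hδ hη0))
  rw [eventually_comap] at hev
  obtain ⟨ε, hε, hball⟩ := Metric.eventually_nhds_iff.1 hev
  refine ⟨ε, hε, fun F hF => ?_⟩
  have h0 : 0 ≤ halmos A₂ E.prod F.prod := tsum_nonneg fun i => by positivity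
  have h1 := hball (y := halmos A₂ E.prod F.prod)
    (by rwa [Real.dist_eq, sub_zero, abs_of_nonneg h0]) F rfl
  have h2 : μ.real {x | δ ≤ dev A n E F x} < η :=
    lt_of_mul_lt_mul_left ((markov_dev A hAm n E F δ hδ).trans_lt h1) hδ.le
  have hsub : {x | f E x < r - δ} ⊆ {x | f F x < r} ∪ {x | δ ≤ dev A n E F x} := by
    intro x hx
    by_cases hd : δ ≤ dev A n E F x
    · exact Or.inr hd
    · left
      have := halmos_le_dev A hAm n E F x
      simp only [mem_setOf_eq, hf] at hx ⊢
      linarith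
  have h3 := (measureReal_mono hsub (μ := μ)).trans (measureReal_union_le _ _)
  change c < μ.real {x | f F x < r}
  linarith

end Helpers

/-- The map `R ↦ μ {x : ρ(C(x,n,R), Id) < 1/m}` is lower semicontinuous on
`Ext(S)`, and hence its superlevel set at `0` is open. -/
theorem measure_D_lsc {X : Type*} [MeasurableSpace X] [StandardBorelSpace X]
    (μ : Measure X) [IsProbabilityMeasure μ] (S : Aut X μ)
    (A : ℕ → Set X) (hAm : ∀ i, MeasurableSet (A i))
    (hAd : ∀ B : Set X, MeasurableSet B → ∀ ε > (0 : ℝ),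
      ∃ i, μ (symmDiff B (A i)) < ENNReal.ofReal ε)
    (A₂ : ℕ → Set (X × X)) (hA₂m : ∀ i, MeasurableSet (A₂ i))
    (hA₂d : ∀ B : Set (X × X), MeasurableSet B → ∀ ε > (0 : ℝ),
      ∃ i, (μ.prod μ) (symmDiff B (A₂ i)) < ENNReal.ofReal ε)
    (m n : ℕ) (hm : 1 ≤ m) (hn : 1 ≤ n) :
    (∀ E : SkewExt S, ∀ c : ℝ,
        c < (μ {x : X | halmos A (cocycle S E.T x n) (Aut.id μ) < 1 / m}).toReal →
        ∃ ε > (0 : ℝ), ∀ F : SkewExt S, halmos A₂ E.prod F.prod < ε →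
          c < (μ {x : X | halmos A (cocycle S F.T x n) (Aut.id μ) < 1 / m}).toReal) ∧
    IsOpenWrt (fun E F : SkewExt S => halmos A₂ E.prod F.prod)
      {E : SkewExt S |
        0 < μ {x : X | halmos A (cocycle S E.T x n) (Aut.id μ) < 1 / m}} := by
  have key := lsc_aux (S := S) A hAm A₂ hA₂m hA₂d (1 / m) n
  refine ⟨key, ?_⟩
  intro E hE
  obtain ⟨ε, hε, h⟩ := key E 0 (ENNReal.toReal_pos (ne_of_gt hE) (measure_ne_top _ _))
  exact ⟨ε, hε, fun F hF => (ENNReal.toReal_pos_iff.1 (h F hF)).1⟩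
end

section
/- Let S be aperiodic and A ⊆ X a set of positive measure. Then the set Rec(S, A) of extensions recurrent on A contains a dense G_δ subset of Ext(S). -/
open MeasureTheory Set

/-! ### Helper lemmas -/

section Helpers

open Filter Topology
open scoped ENNReal

namespace RecAux

section Gen

variable {Y : Type*} [MeasurableSpace Y] {ν : Measure Y} [IsProbabilityMeasure ν]

lemma geo2 : Summable (fun i : ℕ => (1 / 2 : ℝ) ^ i * 2) :=
  summable_geometric_two.mul_right 2

lemma toReal_le_one (s : Set Y) : (ν s).toReal ≤ 1 := by
  have h : ν s ≤ 1 := prob_le_one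
  exact ENNReal.toReal_le_of_le_ofReal zero_le_one (by simpa using h)

lemma halmos_summable (A : ℕ → Set Y) (P Q : Aut Y ν) :
    Summable (fun i : ℕ => (1 / 2 : ℝ) ^ i *
    ((ν (symmDiff (P.toEquiv '' A i) (Q.toEquiv '' A i))).toReal +
     (ν (symmDiff (P.toEquiv.symm '' A i) (Q.toEquiv.symm '' A i))).toReal)) := by
  refine Summable.of_nonneg_of_le (fun i => by positivity) (fun i => ?_) geo2
  have h1 := toReal_le_one (ν := ν) (symmDiff (P.toEquiv '' A i) (Q.toEquiv '' A i))
  have h2 := toReal_le_one (ν := ν) (symmDiff (P.toEquiv.symm '' A i) (Q.toEquiv.symm '' A i))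
  gcongr
  linarith

lemma halmos_nonneg (A : ℕ → Set Y) (P Q : Aut Y ν) : 0 ≤ halmos A P Q :=
  tsum_nonneg fun i => by positivity

/-- A single term of the Halmos metric is bounded by the whole. -/
lemma term_le_halmos (A : ℕ → Set Y) (P Q : Aut Y ν) (i : ℕ) :
    (1 / 2 : ℝ) ^ i * (ν (symmDiff (P.toEquiv ⁻¹' A i) (Q.toEquiv ⁻¹' A i))).toReal
      ≤ halmos A P Q := by
  refine le_trans ?_ ((halmos_summable A P Q).le_tsum i (fun j _ => by positivity))
  rw [MeasurableEquiv.image_symm, MeasurableEquiv.image_symm]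
  gcongr
  exact le_add_of_nonneg_left ENNReal.toReal_nonneg

/-- Two automorphisms with small differing sets are close. -/
lemma halmos_le_of (A : ℕ → Set Y) (P Q : Aut Y ν) (c : ℝ) (hc : 0 ≤ c)
    (U V : Set Y) (hU : (ν U).toReal ≤ c) (hV : (ν V).toReal ≤ c)
    (h1 : ∀ y, y ∉ U → P.toEquiv.symm y = Q.toEquiv.symm y)
    (h2 : ∀ y, y ∉ V → P.toEquiv y = Q.toEquiv y) :
    halmos A P Q ≤ 4 * c := by
  have hs : HasSum (fun i : ℕ => (1 / 2 : ℝ) ^ i * (2 * c)) (2 * (2 * c)) :=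
    hasSum_geometric_two.mul_right _
  have : halmos A P Q ≤ 2 * (2 * c) := by
    rw [← hs.tsum_eq]
    refine (halmos_summable A P Q).tsum_le_tsum (fun i => ?_) hs.summable
    have e1 : (ν (symmDiff (P.toEquiv '' A i) (Q.toEquiv '' A i))).toReal ≤ c := by
      refine le_trans (ENNReal.toReal_mono (measure_ne_top _ _) (measure_mono ?_)) hU
      intro y hy
      by_contra hyU
      simp only [MeasurableEquiv.image_eq_preimage_symm, Set.mem_symmDiff, Set.mem_preimage,
        h1 y hyU] at hy
      tauto
    have e2 : (ν (symmDiff (P.toEquiv.symm '' A i) (Q.toEquiv.symm '' A i))).toReal ≤ c := by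
      refine le_trans (ENNReal.toReal_mono (measure_ne_top _ _) (measure_mono ?_)) hV
      intro y hy
      by_contra hyU
      simp only [MeasurableEquiv.image_symm, Set.mem_symmDiff, Set.mem_preimage,
        h2 y hyU] at hy
      tauto
    gcongr
    linarith
  linarith

/-- Distance to the identity. -/
lemma ofReal_halmos_id (A : ℕ → Set Y) (P : Aut Y ν) :
    ENNReal.ofReal (halmos A P (Aut.id ν)) =
      ∑' i : ℕ, ENNReal.ofReal ((1 / 2 : ℝ) ^ i) *
        (2 * ν (symmDiff (P.toEquiv ⁻¹' A i) (A i))) := by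
  unfold halmos
  rw [ENNReal.ofReal_tsum_of_nonneg (fun i => by positivity) (halmos_summable A P _)]
  congr 1
  ext i
  have a1 : (Aut.id ν).toEquiv '' A i = A i := Set.image_id _
  have a2 : (Aut.id ν).toEquiv.symm '' A i = A i := Set.image_id _
  have a3 : ν (symmDiff (P.toEquiv '' A i) (A i)) =
      ν (symmDiff (P.toEquiv ⁻¹' A i) (A i)) := by
    rw [← P.mp.measure_preimage_equiv, Set.preimage_symmDiff,
      Set.preimage_image_eq _ P.toEquiv.injective, symmDiff_comm]
  rw [a1, a2, a3, MeasurableEquiv.image_symm, ENNReal.ofReal_mul (by positivity),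
    ENNReal.ofReal_add (by positivity) (by positivity),
    ENNReal.ofReal_toReal (measure_ne_top _ _), two_mul]

/-- Convergence in the Halmos metric implies convergence of preimages. -/
lemma tendsto_preimage {ι : Type*} (l : Filter ι) (A : ℕ → Set Y)
    (hAm : ∀ i, MeasurableSet (A i))
    (hAd : ∀ B : Set Y, MeasurableSet B → ∀ ε > (0 : ℝ),
      ∃ i, ν (symmDiff B (A i)) < ENNReal.ofReal ε)
    (P : Aut Y ν) (Q : ι → Aut Y ν) (h : Tendsto (fun j => halmos A P (Q j)) l (𝓝 0))
    (W : Set Y) (hW : MeasurableSet W) :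
    Tendsto (fun j => ν (symmDiff (P.toEquiv ⁻¹' W) ((Q j).toEquiv ⁻¹' W))) l (𝓝 0) := by
  rw [ENNReal.tendsto_nhds_zero]
  intro ε hε
  obtain ⟨r, hr0, hr⟩ : ∃ r : ℝ, 0 < r ∧ ENNReal.ofReal r ≤ ε := by
    by_cases ht : ε = ⊤
    · exact ⟨1, one_pos, by simp [ht]⟩
    · exact ⟨ε.toReal, ENNReal.toReal_pos hε.ne' ht, by rw [ENNReal.ofReal_toReal ht]⟩
  obtain ⟨i, hi⟩ := hAd W hW (r / 3) (by positivity)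
  have hev : ∀ᶠ j in l, halmos A P (Q j) < (1 / 2 : ℝ) ^ i * (r / 3) :=
    h.eventually (gt_mem_nhds (by positivity))
  filter_upwards [hev] with j hj
  have h1 := (term_le_halmos A P (Q j) i).trans_lt hj
  have h2 := lt_of_mul_lt_mul_left h1 (by positivity)
  have h3 : ν (symmDiff (P.toEquiv ⁻¹' A i) ((Q j).toEquiv ⁻¹' A i)) ≤ ENNReal.ofReal (r / 3) := by
    rw [← ENNReal.ofReal_toReal (measure_ne_top ν _)]
    exact ENNReal.ofReal_le_ofReal h2.le
  have h4 : ν (symmDiff (P.toEquiv ⁻¹' W) (P.toEquiv ⁻¹' A i)) ≤ ENNReal.ofReal (r / 3) := by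
    rw [← Set.preimage_symmDiff, P.mp.measure_preimage_equiv]
    exact hi.le
  have h5 : ν (symmDiff ((Q j).toEquiv ⁻¹' A i) ((Q j).toEquiv ⁻¹' W))
      ≤ ENNReal.ofReal (r / 3) := by
    rw [← Set.preimage_symmDiff, (Q j).mp.measure_preimage_equiv, symmDiff_comm]
    exact hi.le
  calc _ ≤ _ := measure_symmDiff_le _ (P.toEquiv ⁻¹' A i) _
    _ ≤ _ + (_ + _) := by
        gcongr
        exact measure_symmDiff_le _ ((Q j).toEquiv ⁻¹' A i) _
    _ ≤ ENNReal.ofReal (r / 3) + (ENNReal.ofReal (r / 3) + ENNReal.ofReal (r / 3)) := by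
        gcongr
    _ = ENNReal.ofReal r := by
        rw [← ENNReal.ofReal_add (by positivity) (by positivity),
          ← ENNReal.ofReal_add (by positivity) (by positivity)]
        congr 1
        ring
    _ ≤ ε := hr

lemma tendsto_iterate {ι : Type*} (l : Filter ι) (A : ℕ → Set Y)
    (hAm : ∀ i, MeasurableSet (A i))
    (hAd : ∀ B : Set Y, MeasurableSet B → ∀ ε > (0 : ℝ),
      ∃ i, ν (symmDiff B (A i)) < ENNReal.ofReal ε)
    (P : Aut Y ν) (Q : ι → Aut Y ν) (h : Tendsto (fun j => halmos A P (Q j)) l (𝓝 0))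
    (W : Set Y) (hW : MeasurableSet W) (n : ℕ) :
    Tendsto (fun j => ν (symmDiff (P.toEquiv^[n] ⁻¹' W) ((Q j).toEquiv^[n] ⁻¹' W))) l (𝓝 0) := by
  induction n with
  | zero => simpa using tendsto_const_nhds
  | succ n ih =>
    have hm : MeasurableSet (P.toEquiv^[n] ⁻¹' W) := (P.toEquiv.measurable.iterate n) hW
    have h1 := tendsto_preimage l A hAm hAd P Q h _ hm
    have h2 := h1.add ih
    rw [add_zero] at h2
    refine tendsto_of_tendsto_of_tendsto_of_le_of_le tendsto_const_nhds h2
      (fun _ => zero_le) (fun j => ?_)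
    simp only [Function.iterate_succ, Set.preimage_comp]
    refine (measure_symmDiff_le _ ((Q j).toEquiv ⁻¹' (P.toEquiv^[n] ⁻¹' W)) _).trans ?_
    refine add_le_add le_rfl ?_
    rw [← Set.preimage_symmDiff, (Q j).mp.measure_preimage_equiv]

end Gen

variable {X : Type*} [MeasurableSpace X] {μ : Measure X}

lemma iterate_prod {S : Aut X μ} (E : SkewExt S) (n : ℕ) (x y : X) :
    E.prod.toEquiv^[n] (x, y) = (S.toEquiv^[n] x, (cocycle S E.T x n).toEquiv y) := by
  induction n with
  | zero => rfl
  | succ n ih =>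
    rw [Function.iterate_succ_apply', ih, E.spec, Function.iterate_succ_apply']
    rfl

/-- `Φ(E, n, B) = ∫_B ρ(C(x,n,E), Id) dμ(x)`, written through the product space. -/
noncomputable def Phi [SFinite μ] {S : Aut X μ} (A : ℕ → Set X) (E : SkewExt S) (n : ℕ)
    (B : Set X) : ℝ≥0∞ :=
  ∑' i : ℕ, ENNReal.ofReal ((1 / 2 : ℝ) ^ i) *
    (2 * ((μ.restrict B).prod μ)
      (symmDiff (E.prod.toEquiv^[n] ⁻¹' (Prod.snd ⁻¹' A i)) (Prod.snd ⁻¹' A i)))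

lemma Phi_eq [IsProbabilityMeasure μ] {S : Aut X μ} (A : ℕ → Set X)
    (hAm : ∀ i, MeasurableSet (A i)) (E : SkewExt S) (n : ℕ) (B : Set X) :
    Phi A E n B = ∫⁻ x in B, ENNReal.ofReal (halmos A (cocycle S E.T x n) (Aut.id μ)) ∂μ := by
  have hm : ∀ i, MeasurableSet
      (symmDiff (E.prod.toEquiv^[n] ⁻¹' (Prod.snd ⁻¹' A i)) (Prod.snd ⁻¹' A i)) := fun i =>
    ((E.prod.toEquiv.measurable.iterate n) (measurable_snd (hAm i))).symmDiff
      (measurable_snd (hAm i))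
  have hsec : ∀ i x, μ (Prod.mk x ⁻¹'
      (symmDiff (E.prod.toEquiv^[n] ⁻¹' (Prod.snd ⁻¹' A i)) (Prod.snd ⁻¹' A i))) =
      μ (symmDiff ((cocycle S E.T x n).toEquiv ⁻¹' A i) (A i)) := by
    intro i x
    congr 1
    ext y
    simp [Set.mem_symmDiff, iterate_prod]
  simp_rw [ofReal_halmos_id]
  have hmeas : ∀ i, Measurable fun x =>
      μ (symmDiff ((cocycle S E.T x n).toEquiv ⁻¹' A i) (A i)) := by
    intro i
    simp_rw [← hsec]
    exact measurable_measure_prodMk_left (hm i)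
  rw [lintegral_tsum (fun i => (((hmeas i).const_mul 2).const_mul _).aemeasurable)]
  unfold Phi
  congr 1
  ext i
  rw [lintegral_const_mul _ ((hmeas i).const_mul 2), lintegral_const_mul _ (hmeas i),
    Measure.prod_apply (hm i)]
  simp_rw [hsec]

/-- The basic open sets. -/
def U [SFinite μ] (S : Aut X μ) (A : ℕ → Set X) (A₀ : Set X) (k : ℕ) : Set (SkewExt S) :=
  {E | ∃ n > k, ∃ B ⊆ A₀, MeasurableSet B ∧
    Phi A E n B < ENNReal.ofReal (1 / ((k : ℝ) + 1)) * μ B}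

lemma pos_of_mem_U [IsProbabilityMeasure μ] {S : Aut X μ} (A : ℕ → Set X)
    (hAm : ∀ i, MeasurableSet (A i)) (E : SkewExt S) (n : ℕ) (A₀ B : Set X) (hB : B ⊆ A₀)
    (hBm : MeasurableSet B) (c : ℝ)
    (h : Phi A E n B < ENNReal.ofReal c * μ B) :
    0 < μ {x : X | x ∈ A₀ ∧ halmos A (cocycle S E.T x n) (Aut.id μ) < c} := by
  rw [pos_iff_ne_zero]
  intro h0
  refine absurd h (not_lt.2 ?_)
  rw [Phi_eq A hAm]
  calc ENNReal.ofReal c * μ B = ∫⁻ x in B, ENNReal.ofReal c ∂μ := by simp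
    _ ≤ _ := by
      refine lintegral_mono_ae ?_
      rw [ae_restrict_iff' hBm]
      have : ∀ᵐ x ∂μ, ¬ (x ∈ A₀ ∧ halmos A (cocycle S E.T x n) (Aut.id μ) < c) := by
        rw [ae_iff]
        simpa using h0
      filter_upwards [this] with x hx hxB
      refine ENNReal.ofReal_le_ofReal ?_
      by_contra hc
      exact hx ⟨hB hxB, not_le.1 hc⟩

lemma isOpen_U [IsProbabilityMeasure μ] (S : Aut X μ) (A : ℕ → Set X)
    (hAm : ∀ i, MeasurableSet (A i))
    (A₂ : ℕ → Set (X × X)) (hA₂m : ∀ i, MeasurableSet (A₂ i))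
    (hA₂d : ∀ B : Set (X × X), MeasurableSet B → ∀ ε > (0 : ℝ),
      ∃ i, (μ.prod μ) (symmDiff B (A₂ i)) < ENNReal.ofReal ε)
    (A₀ : Set X) (k : ℕ) :
    IsOpenWrt (fun E F : SkewExt S => halmos A₂ E.prod F.prod) (U S A A₀ k) := by
  rintro E ⟨n, hn, B, hB, hBm, hlt⟩
  set l : Filter (SkewExt S) := comap (fun F => halmos A₂ E.prod F.prod) (𝓝 0) with hl
  have hT : Tendsto (fun F : SkewExt S => halmos A₂ E.prod F.prod) l (𝓝 0) := tendsto_comap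
  let w : SkewExt S → ℕ → ℝ≥0∞ := fun F i =>
    (μ.prod μ) (symmDiff (E.prod.toEquiv^[n] ⁻¹' (Prod.snd ⁻¹' A i))
      (F.prod.toEquiv^[n] ⁻¹' (Prod.snd ⁻¹' A i)))
  have hw : ∀ i, Tendsto (fun F => w F i) l (𝓝 0) := fun i =>
    tendsto_iterate l A₂ hA₂m hA₂d E.prod (fun F : SkewExt S => F.prod) hT _
      (measurable_snd (hAm i)) n
  have hw1 : ∀ F i, (w F i).toReal ≤ 1 := fun F i => toReal_le_one _
  have hsum : ∀ F, Summable fun i : ℕ => (1 / 2 : ℝ) ^ i * (2 * (w F i).toReal) := by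
    intro F
    refine Summable.of_nonneg_of_le (fun i => by positivity) (fun i => ?_) geo2
    gcongr
    linarith [hw1 F i]
  have hreal : Tendsto (fun F => ∑' i : ℕ, (1 / 2 : ℝ) ^ i * (2 * (w F i).toReal)) l (𝓝 0) := by
    have := tendsto_tsum_of_dominated_convergence (𝓕 := l)
      (f := fun F i => (1 / 2 : ℝ) ^ i * (2 * (w F i).toReal)) (g := fun _ : ℕ => (0 : ℝ))
      geo2 (fun i => ?_) (Eventually.of_forall fun F i => ?_)
    · simpa using this
    · have h1 := (ENNReal.tendsto_toReal ENNReal.zero_ne_top).comp (hw i)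
      have h2 := (h1.const_mul 2).const_mul ((1 / 2 : ℝ) ^ i)
      simpa using h2
    · rw [Real.norm_of_nonneg (by positivity)]
      gcongr
      linarith [hw1 F i]
  have henn : Tendsto (fun F => Phi A E n B +
      ENNReal.ofReal (∑' i : ℕ, (1 / 2 : ℝ) ^ i * (2 * (w F i).toReal))) l
      (𝓝 (Phi A E n B)) := by
    have := (tendsto_const_nhds (x := Phi A E n B)).add (ENNReal.tendsto_ofReal hreal)
    simpa using this
  have hle : ∀ F, Phi A F n B ≤ Phi A E n B +
      ENNReal.ofReal (∑' i : ℕ, (1 / 2 : ℝ) ^ i * (2 * (w F i).toReal)) := by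
    intro F
    rw [ENNReal.ofReal_tsum_of_nonneg (fun i => by positivity) (hsum F)]
    unfold Phi
    rw [← ENNReal.tsum_add]
    refine ENNReal.tsum_le_tsum fun i => ?_
    rw [ENNReal.ofReal_mul (by positivity), ENNReal.ofReal_mul (by positivity),
      ENNReal.ofReal_toReal (measure_ne_top _ _), ← mul_add, ENNReal.ofReal_ofNat, ← mul_add]
    gcongr
    refine (measure_symmDiff_le _ (E.prod.toEquiv^[n] ⁻¹' (Prod.snd ⁻¹' A i)) _).trans ?_
    rw [add_comm]
    refine add_le_add le_rfl ?_
    rw [symmDiff_comm]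
    have hr : (μ.restrict B).prod μ ≤ μ.prod μ := by
      have := Measure.prod_restrict (μ := μ) (ν := μ) B univ
      rw [Measure.restrict_univ] at this
      rw [this]
      exact Measure.restrict_le_self
    exact hr _
  have hev : ∀ᶠ F in l, F ∈ U S A A₀ k := by
    filter_upwards [henn.eventually (gt_mem_nhds hlt)] with F hF
    exact ⟨n, hn, B, hB, hBm, (hle F).trans_lt hF⟩
  rw [hl, eventually_comap, Metric.eventually_nhds_iff] at hev
  obtain ⟨ε, hε, H⟩ := hev
  refine ⟨ε, hε, fun F hF => H (y := halmos A₂ E.prod F.prod) ?_ F rfl⟩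
  rw [Real.dist_eq, sub_zero, abs_of_nonneg (halmos_nonneg _ _ _)]
  exact hF

/-- Small subsets of positive measure. -/
lemma exists_small [StandardBorelSpace X] [IsProbabilityMeasure μ] (S : Aut X μ)
    (hS : Aperiodic S) (A₀ : Set X) (hA₀m : MeasurableSet A₀) (hA₀ : 0 < μ A₀)
    (ε : ℝ≥0∞) (hε : 0 < ε) : ∃ B ⊆ A₀, MeasurableSet B ∧ 0 < μ B ∧ μ B < ε := by
  let _ := upgradeStandardBorel X
  obtain ⟨x, hx, H⟩ := exists_mem_forall_mem_nhdsWithin_pos_measure hA₀.ne'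
  have hx0 : μ {x} = 0 := by
    by_contra h
    have := S.mp.conservative.frequently_measure_inter_ne_zero
      (measurableSet_singleton x).nullMeasurableSet h
    obtain ⟨n, hn, hne⟩ := (frequently_atTop.1 this) 1
    refine hne (measure_mono_null ?_ (hS n hn))
    rintro y ⟨rfl, hy⟩
    exact hy
  obtain ⟨V, hV, hVo, hVε⟩ := Set.exists_isOpen_lt_of_lt (μ := μ) {x} ε (by rw [hx0]; exact hε)
  refine ⟨A₀ ∩ V, inter_subset_left, hA₀m.inter hVo.measurableSet, H _ ?_,
    (measure_mono inter_subset_right).trans_lt hVε⟩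
  exact inter_mem_nhdsWithin _ (hVo.mem_nhds (hV rfl))

lemma cocycle_add {S : Aut X μ} (T : X → Aut X μ) (x : X) (m n : ℕ) (y : X) :
    (cocycle S T x (m + n)).toEquiv y =
      (cocycle S T (S.toEquiv^[m] x) n).toEquiv ((cocycle S T x m).toEquiv y) := by
  induction n with
  | zero => rfl
  | succ n ih =>
    change (T (S.toEquiv^[m + n] x)).toEquiv ((cocycle S T x (m + n)).toEquiv y) =
      (T (S.toEquiv^[n] (S.toEquiv^[m] x))).toEquiv _
    rw [ih, ← Function.iterate_add_apply, add_comm n m]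
    rfl

lemma cocycle_congr {S : Aut X μ} (T T' : X → Aut X μ) (x : X) (n : ℕ)
    (h : ∀ j < n, T (S.toEquiv^[j] x) = T' (S.toEquiv^[j] x)) :
    cocycle S T x n = cocycle S T' x n := by
  induction n with
  | zero => rfl
  | succ n ih =>
    change (T (S.toEquiv^[n] x)).comp _ = (T' (S.toEquiv^[n] x)).comp _
    rw [ih (fun j hj => h j (hj.trans (Nat.lt_succ_self n))), h n (Nat.lt_succ_self n)]

lemma measurable_cocycle {S : Aut X μ} (E : SkewExt S) (n : ℕ) :
    Measurable fun p : X × X => (cocycle S E.T p.1 n).toEquiv p.2 := by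
  have : (fun p : X × X => (cocycle S E.T p.1 n).toEquiv p.2) =
      fun p => (E.prod.toEquiv^[n] p).2 := by
    ext ⟨x, y⟩
    rw [iterate_prod]
  rw [this]
  exact measurable_snd.comp (E.prod.toEquiv.measurable.iterate n)

lemma measurable_cocycle_symm {S : Aut X μ} (E : SkewExt S) (n : ℕ) :
    Measurable fun p : X × X => (cocycle S E.T p.1 n).toEquiv.symm p.2 := by
  have : (fun p : X × X => (cocycle S E.T p.1 n).toEquiv.symm p.2) =
      fun p => (E.prod.toEquiv.symm^[n] (S.toEquiv^[n] p.1, p.2)).2 := by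
    ext ⟨x, y⟩
    have h := iterate_prod E n x ((cocycle S E.T x n).toEquiv.symm y)
    rw [MeasurableEquiv.apply_symm_apply] at h
    simp only
    rw [← h, (Function.LeftInverse.iterate E.prod.toEquiv.symm_apply_apply n) _]
  rw [this]
  exact measurable_snd.comp ((E.prod.toEquiv.symm.measurable.iterate n).comp
    (((S.toEquiv.measurable.iterate n).comp measurable_fst).prodMk measurable_snd))

open Classical in
/-- First return time to `B` (`0` off `B` and when there is no return). -/
noncomputable def ret (S : Aut X μ) (B : Set X) (x : X) : ℕ :=
  Nat.find (p := fun k => (1 ≤ k ∧ x ∈ B ∧ S.toEquiv^[k] x ∈ B) ∨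
      ¬ ∃ k, 1 ≤ k ∧ x ∈ B ∧ S.toEquiv^[k] x ∈ B)
    (by
      by_cases h : ∃ k, 1 ≤ k ∧ x ∈ B ∧ S.toEquiv^[k] x ∈ B
      · exact h.imp fun k hk => Or.inl hk
      · exact ⟨0, Or.inr h⟩)

lemma measurable_ret (S : Aut X μ) (B : Set X) (hB : MeasurableSet B) :
    Measurable (ret S B) := by
  classical
  unfold ret
  refine measurable_find _ fun k => ?_
  have h1 : ∀ k, MeasurableSet {x | 1 ≤ k ∧ x ∈ B ∧ S.toEquiv^[k] x ∈ B} := fun k =>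
    (MeasurableSet.const _).inter (hB.inter ((S.toEquiv.measurable.iterate k) hB))
  have h2 : MeasurableSet {x | ∃ k, 1 ≤ k ∧ x ∈ B ∧ S.toEquiv^[k] x ∈ B} := by
    rw [Set.ofPred_exists]
    exact MeasurableSet.iUnion h1
  exact (h1 k).union h2.compl

lemma ret_of_notMem (S : Aut X μ) (B : Set X) (x : X) (hx : x ∉ B) : ret S B x = 0 := by
  classical
  unfold ret
  rw [Nat.find_eq_zero]
  right
  rintro ⟨k, -, h, -⟩
  exact hx h

lemma ret_spec (S : Aut X μ) (B : Set X) (x : X) (n : ℕ) (hn : 1 ≤ n) (hx : x ∈ B)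
    (hxn : S.toEquiv^[n] x ∈ B) :
    1 ≤ ret S B x ∧ ret S B x ≤ n ∧ S.toEquiv^[ret S B x] x ∈ B ∧
      ∀ j, 1 ≤ j → j < ret S B x → S.toEquiv^[j] x ∉ B := by
  classical
  have hex : ∃ k, 1 ≤ k ∧ x ∈ B ∧ S.toEquiv^[k] x ∈ B := ⟨n, hn, hx, hxn⟩
  have hs : (1 ≤ ret S B x ∧ x ∈ B ∧ S.toEquiv^[ret S B x] x ∈ B) ∨
      ¬ ∃ k, 1 ≤ k ∧ x ∈ B ∧ S.toEquiv^[k] x ∈ B := by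
    unfold ret
    exact Nat.find_spec (p := fun k => (1 ≤ k ∧ x ∈ B ∧ S.toEquiv^[k] x ∈ B) ∨
      ¬ ∃ k, 1 ≤ k ∧ x ∈ B ∧ S.toEquiv^[k] x ∈ B) _
  have hs' := hs.resolve_right (not_not.2 hex)
  refine ⟨hs'.1, ?_, hs'.2.2, ?_⟩
  · unfold ret
    exact Nat.find_min' _ (Or.inl ⟨hn, hx, hxn⟩)
  · intro j hj hlt hmem
    unfold ret at hlt
    exact Nat.find_min _ hlt (Or.inl ⟨hj, hx, hmem⟩)

/-- The choice of fibre map as a function of the return time. -/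
noncomputable def fib {S : Aut X μ} (E : SkewExt S) (x : X) : ℕ → Aut X μ
  | 0 => E.T x
  | n + 1 => (cocycle S E.T (S.toEquiv x) n).inv

lemma measurable_fib {S : Aut X μ} (E : SkewExt S) (n : ℕ) :
    Measurable fun p : X × X => (fib E p.1 n).toEquiv p.2 := by
  cases n with
  | zero => exact measurable_cocycle E 1
  | succ n =>
    exact (measurable_cocycle_symm E n).comp
      ((S.toEquiv.measurable.comp measurable_fst).prodMk measurable_snd)

lemma measurable_fib_symm {S : Aut X μ} (E : SkewExt S) (n : ℕ) :
    Measurable fun p : X × X => (fib E p.1 n).toEquiv.symm p.2 := by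
  cases n with
  | zero => exact measurable_cocycle_symm E 1
  | succ n =>
    exact (measurable_cocycle E n).comp
      ((S.toEquiv.measurable.comp measurable_fst).prodMk measurable_snd)

lemma measurable_pertFib {S : Aut X μ} (E : SkewExt S) (B : Set X) (hB : MeasurableSet B) :
    Measurable fun p : X × X => (fib E p.1 (ret S B p.1)).toEquiv p.2 :=
  (measurable_from_prod_countable_right
    (f := fun q : ℕ × (X × X) => (fib E q.2.1 q.1).toEquiv q.2.2)
    (fun n => measurable_fib E n)).comp
      (((measurable_ret S B hB).comp measurable_fst).prodMk measurable_id)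

lemma measurable_pertFib_symm {S : Aut X μ} (E : SkewExt S) (B : Set X) (hB : MeasurableSet B) :
    Measurable fun p : X × X => (fib E p.1 (ret S B p.1)).toEquiv.symm p.2 :=
  (measurable_from_prod_countable_right
    (f := fun q : ℕ × (X × X) => (fib E q.2.1 q.1).toEquiv.symm q.2.2)
    (fun n => measurable_fib_symm E n)).comp
      (((measurable_ret S B hB).comp measurable_fst).prodMk measurable_id)

/-- A measurable fibre family gives a skew product equivalence. -/
def skewEquiv (S : Aut X μ) (T : X → Aut X μ)
    (hf : Measurable fun p : X × X => (T p.1).toEquiv p.2)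
    (hfs : Measurable fun p : X × X => (T p.1).toEquiv.symm p.2) : (X × X) ≃ᵐ (X × X) where
  toFun := fun p => (S.toEquiv p.1, (T p.1).toEquiv p.2)
  invFun := fun q => (S.toEquiv.symm q.1, (T (S.toEquiv.symm q.1)).toEquiv.symm q.2)
  left_inv := fun p => by simp
  right_inv := fun q => by simp
  measurable_toFun := (S.toEquiv.measurable.comp measurable_fst).prodMk hf
  measurable_invFun := (S.toEquiv.symm.measurable.comp measurable_fst).prodMk
    (hfs.comp ((S.toEquiv.symm.measurable.comp measurable_fst).prodMk measurable_snd))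

/-- A measurable fibre family gives a skew product. -/
def mkSkew [IsProbabilityMeasure μ] (S : Aut X μ) (T : X → Aut X μ)
    (hf : Measurable fun p : X × X => (T p.1).toEquiv p.2)
    (hfs : Measurable fun p : X × X => (T p.1).toEquiv.symm p.2) : SkewExt S where
  T := T
  prod :=
    { toEquiv := skewEquiv S T hf hfs
      mp := S.mp.skew_product (g := fun x y => (T x).toEquiv y) hf
        (Eventually.of_forall fun x => (T x).mp.map_eq) }
  spec := fun _ => rfl

/-- The perturbed extension: on `B` the fibre map undoes the cocycle over the first return. -/
noncomputable def pert [IsProbabilityMeasure μ] {S : Aut X μ} (E : SkewExt S) (B : Set X)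
    (hB : MeasurableSet B) : SkewExt S :=
  mkSkew S (fun x => fib E x (ret S B x)) (measurable_pertFib E B hB)
    (measurable_pertFib_symm E B hB)

lemma pert_cocycle [IsProbabilityMeasure μ] {S : Aut X μ} (E : SkewExt S) (B : Set X)
    (hB : MeasurableSet B) (n : ℕ) : ∀ x, x ∈ B → S.toEquiv^[n] x ∈ B → ∀ y,
    (cocycle S (pert E B hB).T x n).toEquiv y = y := by
  induction n using Nat.strong_induction_on with
  | _ n ih =>
    intro x hx hxn y
    rcases Nat.eq_zero_or_pos n with rfl | hn
    · rfl
    obtain ⟨h1, h2, h3, h4⟩ := ret_spec S B x n hn hx hxn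
    obtain ⟨r, hr⟩ : ∃ r, ret S B x = r + 1 := ⟨ret S B x - 1, by omega⟩
    rw [hr] at h2 h3 h4
    have hfirst : ∀ y, (cocycle S (pert E B hB).T x (r + 1)).toEquiv y = y := by
      intro y
      rw [add_comm r 1, cocycle_add]
      have hc : cocycle S (pert E B hB).T (S.toEquiv^[1] x) r =
          cocycle S E.T (S.toEquiv^[1] x) r := by
        refine cocycle_congr _ _ _ _ fun j hj => ?_
        rw [← Function.iterate_add_apply]
        have hnot := h4 (j + 1) (by omega) (by omega)
        change fib E _ (ret S B _) = _
        rw [ret_of_notMem S B _ hnot]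
        rfl
      rw [hc]
      change (cocycle S E.T (S.toEquiv x) r).toEquiv ((fib E x (ret S B x)).toEquiv y) = y
      rw [hr]
      exact (cocycle S E.T (S.toEquiv x) r).toEquiv.apply_symm_apply y
    obtain ⟨k, rfl⟩ := Nat.exists_eq_add_of_le h2
    rw [cocycle_add, hfirst]
    refine ih k (by omega) _ h3 ?_ y
    rw [← Function.iterate_add_apply, add_comm k]
    exact hxn

lemma pert_close [IsProbabilityMeasure μ] {S : Aut X μ} (E : SkewExt S) (B : Set X)
    (hB : MeasurableSet B) (A₂ : ℕ → Set (X × X)) :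
    halmos A₂ E.prod (pert E B hB).prod ≤ 4 * (μ B).toReal := by
  have key : ∀ p : X × X, p.1 ∉ B →
      E.prod.toEquiv p = (pert E B hB).prod.toEquiv p := by
    intro p hp
    rw [E.spec, (pert E B hB).spec]
    change _ = (_, (fib E p.1 (ret S B p.1)).toEquiv p.2)
    rw [ret_of_notMem S B _ hp]
    rfl
  have hSB : MeasurableSet (S.toEquiv.symm ⁻¹' B) := S.toEquiv.symm.measurable hB
  refine halmos_le_of A₂ _ _ _ ENNReal.toReal_nonneg ((S.toEquiv.symm ⁻¹' B) ×ˢ univ)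
    (B ×ˢ univ) ?_ ?_ ?_ ?_
  · rw [Measure.prod_prod, measure_univ, mul_one,
      (S.mp.symm S.toEquiv).measure_preimage hB.nullMeasurableSet]
  · rw [Measure.prod_prod, measure_univ, mul_one]
  · intro q hq
    have hq' : S.toEquiv.symm q.1 ∉ B := fun h => hq ⟨h, trivial⟩
    rw [MeasurableEquiv.symm_apply_eq]
    have hp : ((pert E B hB).prod.toEquiv.symm q).1 = S.toEquiv.symm q.1 := rfl
    rw [key _ (by rw [hp]; exact hq'), MeasurableEquiv.apply_symm_apply]
  · intro p hp
    exact key p fun h => hp ⟨h, trivial⟩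

lemma pert_mem_U [IsProbabilityMeasure μ] {S : Aut X μ} (A : ℕ → Set X)
    (hAm : ∀ i, MeasurableSet (A i)) (A₀ : Set X) (E : SkewExt S) (B : Set X)
    (hB : MeasurableSet B) (hBA : B ⊆ A₀) (hpos : 0 < μ B) (k : ℕ) :
    pert E B hB ∈ U S A A₀ k := by
  have := S.mp.conservative.frequently_measure_inter_ne_zero hB.nullMeasurableSet hpos.ne'
  obtain ⟨n, hn, hne⟩ := (frequently_atTop.1 this) (k + 1)
  have hm : MeasurableSet (B ∩ S.toEquiv^[n] ⁻¹' B) :=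
    hB.inter ((S.toEquiv.measurable.iterate n) hB)
  refine ⟨n, by omega, B ∩ S.toEquiv^[n] ⁻¹' B, inter_subset_left.trans hBA, hm, ?_⟩
  have h0 : Phi A (pert E B hB) n (B ∩ S.toEquiv^[n] ⁻¹' B) = 0 := by
    rw [Phi_eq A hAm, setLIntegral_congr_fun (g := fun _ => 0) hm]
    · simp
    · intro x hx
      have hid : ((cocycle S (pert E B hB).T x n).toEquiv : X → X) = _root_.id :=
        funext fun y => pert_cocycle E B hB n x hx.1 hx.2 y
      simp only [ofReal_halmos_id, hid]
      simp
  rw [h0]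
  exact ENNReal.mul_pos (by simp; positivity) hne

end RecAux

end Helpers

/-- Theorem 2: if `S` is aperiodic and `μ(A₀) > 0`, then the set `Rec(S, A₀)` of
extensions recurrent on `A₀` contains a dense `G_δ` subset of `Ext(S)`. -/
theorem rec_on_set_contains_dense_Gdelta {X : Type*} [MeasurableSpace X] [StandardBorelSpace X]
    (μ : Measure X) [IsProbabilityMeasure μ] (S : Aut X μ)
    (hS : Aperiodic S)
    (A : ℕ → Set X) (hAm : ∀ i, MeasurableSet (A i))
    (hAd : ∀ B : Set X, MeasurableSet B → ∀ ε > (0 : ℝ),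
      ∃ i, μ (symmDiff B (A i)) < ENNReal.ofReal ε)
    (A₂ : ℕ → Set (X × X)) (hA₂m : ∀ i, MeasurableSet (A₂ i))
    (hA₂d : ∀ B : Set (X × X), MeasurableSet B → ∀ ε > (0 : ℝ),
      ∃ i, (μ.prod μ) (symmDiff B (A₂ i)) < ENNReal.ofReal ε)
    (A₀ : Set X) (hA₀m : MeasurableSet A₀) (hA₀ : 0 < μ A₀) :
    ∃ D : Set (SkewExt S),
      D ⊆ {E : SkewExt S | ∀ m : ℕ, 1 ≤ m → ∀ N : ℕ, ∃ n > N,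
        0 < μ {x : X | x ∈ A₀ ∧ halmos A (cocycle S E.T x n) (Aut.id μ) < 1 / m}} ∧
      IsGdeltaWrt (fun E F : SkewExt S => halmos A₂ E.prod F.prod) D ∧
      IsDenseWrt (fun E F : SkewExt S => halmos A₂ E.prod F.prod) D := by
  refine ⟨⋂ k, RecAux.U S A A₀ k, ?_, ⟨RecAux.U S A A₀,
    fun k => RecAux.isOpen_U S A hAm A₂ hA₂m hA₂d A₀ k, rfl⟩, ?_⟩
  · intro E hE m hm N
    obtain ⟨n, hn, B, hB, hBm, hlt⟩ := Set.mem_iInter.1 hE (max m N)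
    refine ⟨n, lt_of_le_of_lt (le_max_right m N) hn, ?_⟩
    refine lt_of_lt_of_le (RecAux.pos_of_mem_U A hAm E n A₀ B hB hBm _ hlt) (measure_mono ?_)
    rintro x ⟨hx, hx'⟩
    refine ⟨hx, hx'.trans_le ?_⟩
    have h1 : (0 : ℝ) < m := by exact_mod_cast hm
    have h2 : (m : ℝ) ≤ ((max m N : ℕ) : ℝ) := by exact_mod_cast le_max_left m N
    exact one_div_le_one_div_of_le h1 (by linarith)
  · intro E ε hε
    obtain ⟨B, hB, hBm, hpos, hlt⟩ := RecAux.exists_small S hS A₀ hA₀m hA₀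
      (ENNReal.ofReal (ε / 4)) (by simpa using hε)
    refine ⟨RecAux.pert E B hBm, Set.mem_iInter.2 fun k =>
      RecAux.pert_mem_U A hAm A₀ E B hBm hB hpos k, ?_⟩
    refine (RecAux.pert_close E B hBm A₂).trans_lt ?_
    have h1 := (ENNReal.lt_ofReal_iff_toReal_lt (measure_ne_top μ B)).1 hlt
    linarith
end

section
/- If S is aperiodic on a standard probability space, then Rec(S, A) holds generically simultaneously for all sets A in a fixed countable dense (in measure) algebra: the set ⋂_{A ∈ 𝒜, μ(A)>0} Rec(S, A) contains a dense G_δ subset of Ext(S). -/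
open MeasureTheory Set

lemma marker_B {X : Type*} [MeasurableSpace X] [StandardBorelSpace X] (f : X ≃ᵐ X) (n : ℕ) :
    ∃ B : Set X, MeasurableSet B ∧ (∀ x ∈ B, ∀ j, 1 ≤ j → j < n → f^[j] x ∉ B) ∧
      ∀ x, (∀ j, 1 ≤ j → f^[j] x ≠ x) → x ∉ B → ∃ j < n, f^[j] x ∈ B ∨ f.symm^[j] x ∈ B := by
  obtain ⟨g, hgm, hgi⟩ :=
    MeasurableSpace.measurable_injection_nat_bool_of_countablySeparated X
  obtain ⟨e, he⟩ := exists_surjective_nat (Fin n → ℕ × Bool)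
  let C : ℕ → Set X := fun i =>
    {x | ∀ j : Fin n, 1 ≤ (j : ℕ) → g x (e i j).1 = (e i j).2 ∧ g (f^[j] x) (e i j).1 ≠ (e i j).2}
  have hfm : ∀ j, Measurable (f^[j]) := fun j => f.measurable.iterate j
  have hfsm : ∀ j, Measurable (f.symm^[j]) := fun j => f.symm.measurable.iterate j
  have hcoord : ∀ l b, MeasurableSet {x | g x l = b} := fun l b =>
    ((measurable_pi_apply l).comp hgm) (measurableSet_singleton b)
  have hCm : ∀ i, MeasurableSet (C i) := by
    intro i
    have : C i = ⋂ j : Fin n, ⋂ (_ : 1 ≤ (j : ℕ)),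
      ({x | g x (e i j).1 = (e i j).2} ∩ (f^[j] ⁻¹' {x | g x (e i j).1 = (e i j).2})ᶜ) := by
      ext x; simp [C]
    rw [this]
    refine MeasurableSet.iInter fun j => MeasurableSet.iInter fun _ => ?_
    exact (hcoord _ _).inter ((hfm _ (hcoord _ _)).compl)
  let B : ℕ → Set X := fun i => Nat.rec ∅ (fun i Bi =>
    Bi ∪ {x | x ∈ C i ∧ ∀ j : Fin n, f^[j] x ∉ Bi ∧ f.symm^[j] x ∉ Bi}) i
  have hBs : ∀ i, B (i+1) = B i ∪ {x | x ∈ C i ∧ ∀ j : Fin n, f^[j] x ∉ B i ∧ f.symm^[j] x ∉ B i} :=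
    fun i => rfl
  have hBm : ∀ i, MeasurableSet (B i) := by
    intro i
    induction i with
    | zero => exact MeasurableSet.empty
    | succ i ih =>
      rw [hBs]
      refine ih.union ((hCm i).inter ?_)
      have : {x | ∀ j : Fin n, f^[j] x ∉ B i ∧ f.symm^[j] x ∉ B i} =
        ⋂ j : Fin n, ((f^[j] ⁻¹' B i)ᶜ ∩ (f.symm^[j] ⁻¹' B i)ᶜ) := by ext x; simp
      change MeasurableSet {x | ∀ j : Fin n, f^[j] x ∉ B i ∧ f.symm^[j] x ∉ B i}
      rw [this]
      exact MeasurableSet.iInter fun j => ((hfm _ ih).compl).inter ((hfsm _ ih).compl)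
  have hmono : Monotone B := monotone_nat_of_le_succ fun i => by
    rw [hBs]; exact subset_union_left
  have hinv : ∀ j x, f.symm^[j] (f^[j] x) = x := fun j =>
    (Function.LeftInverse.iterate f.symm_apply_apply j)
  have hd : ∀ i, ∀ x ∈ B i, ∀ j, 1 ≤ j → j < n → f^[j] x ∉ B i := by
    intro i
    induction i with
    | zero => intro x hx; exact hx.elim
    | succ i ih =>
      intro x hx j hj hjn hx'
      rw [hBs] at hx hx'
      rcases hx with hx | hx <;> rcases hx' with hx' | hx'
      · exact ih x hx j hj hjn hx'
      · have := (hx'.2 ⟨j, hjn⟩).2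
        simp only [hinv] at this
        exact this hx
      · exact (hx.2 ⟨j, hjn⟩).1 hx'
      · exact (hx.1 ⟨j, hjn⟩ hj).2 (hx'.1 ⟨j, hjn⟩ hj).1
  refine ⟨⋃ i, B i, MeasurableSet.iUnion hBm, ?_, ?_⟩
  · intro x hx j hj hjn hx'
    obtain ⟨a, ha⟩ := mem_iUnion.1 hx
    obtain ⟨b, hb⟩ := mem_iUnion.1 hx'
    exact hd (max a b) x (hmono (le_max_left _ _) ha) j hj hjn (hmono (le_max_right _ _) hb)
  · intro x hx hxB
    have : ∀ j : Fin n, ∃ l : ℕ × Bool, 1 ≤ (j : ℕ) → g x l.1 = l.2 ∧ g (f^[j] x) l.1 ≠ l.2 := by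
      intro j
      by_cases hj : 1 ≤ (j : ℕ)
      · have h1 : g (f^[j] x) ≠ g x := fun h => hx j hj (hgi h)
        obtain ⟨l, hl⟩ := Function.ne_iff.1 h1
        exact ⟨(l, g x l), fun _ => ⟨rfl, hl⟩⟩
      · exact ⟨(0, true), fun h => absurd h hj⟩
    choose l hl using this
    obtain ⟨i, rfl⟩ := he l
    have hxC : x ∈ C i := hl
    by_contra hcon
    push Not at hcon
    apply hxB
    refine mem_iUnion.2 ⟨i+1, ?_⟩
    rw [hBs]
    refine Or.inr ⟨hxC, fun j => ⟨fun h => (hcon j j.2).1 (mem_iUnion.2 ⟨i, h⟩),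
      fun h => (hcon j j.2).2 (mem_iUnion.2 ⟨i, h⟩)⟩⟩

lemma marker {X : Type*} [MeasurableSpace X] [StandardBorelSpace X]
    {μ : Measure X} [IsProbabilityMeasure μ] (S : Aut X μ) (hS : Aperiodic S)
    (ε : ENNReal) (hε : 0 < ε) :
    ∃ L : Set X, MeasurableSet L ∧ μ L < ε ∧ ∀ x, ∃ j, S.toEquiv.symm^[j] x ∈ L := by
  obtain ⟨n, hn⟩ := ENNReal.exists_inv_nat_lt hε.ne'
  set f := S.toEquiv with hf
  have hn0 : 0 < n := by
    rcases Nat.eq_zero_or_pos n with h | h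
    · subst h; simp at hn
    · exact h
  obtain ⟨B, hBm, hBd, hBc⟩ := marker_B f n
  have hmp : ∀ j, MeasurePreserving (f^[j]) μ μ := fun j => S.mp.iterate j
  have hinv : ∀ j x, f^[j] (f.symm^[j] x) = x := fun j =>
    (Function.LeftInverse.iterate f.apply_symm_apply j)
  have hinv' : ∀ j x, f.symm^[j] (f^[j] x) = x := fun j =>
    (Function.LeftInverse.iterate f.symm_apply_apply j)
  have hBμ : μ B ≤ (n : ENNReal)⁻¹ := by
    have hdis : Pairwise (Function.onFun Disjoint (fun j : Fin n => f^[(j : ℕ)] ⁻¹' B)) := by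
      have key : ∀ i j : Fin n, i < j → Disjoint (f^[(i : ℕ)] ⁻¹' B) (f^[(j : ℕ)] ⁻¹' B) := by
        intro i j hij
        rw [Set.disjoint_left]
        intro x hx hx'
        have hij' : (i : ℕ) < j := hij
        refine hBd _ hx (j - i) (by omega) (by omega) ?_
        rw [← Function.iterate_add_apply, Nat.sub_add_cancel hij'.le]
        exact hx'
      intro i j hij
      rcases lt_or_gt_of_ne hij with h | h
      · exact key i j h
      · exact (key j i h).symm
    have h1 : μ (⋃ j : Fin n, f^[(j : ℕ)] ⁻¹' B) = n * μ B := by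
      rw [measure_iUnion hdis (fun j => (hmp j).measurable hBm)]
      simp [(hmp _).measure_preimage hBm.nullMeasurableSet]
    rw [← one_div, ENNReal.le_div_iff_mul_le (by simp) (by simp), mul_comm, ← h1]
    exact prob_le_one
  let L₀ := f^[n] ⁻¹' B
  have hL₀m : MeasurableSet L₀ := (hmp n).measurable hBm
  let Z := (⋃ j, f.symm^[j] ⁻¹' L₀)ᶜ
  have hZm : MeasurableSet Z :=
    (MeasurableSet.iUnion fun j => (f.symm.measurable.iterate j) hL₀m).compl
  have hZ0 : μ Z = 0 := by
    refine measure_mono_null (t := ⋃ j : ℕ, {x | f^[j+1] x = x}) ?_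
      (measure_iUnion_null fun j => hS (j+1) (by omega))
    intro x hx
    by_contra hcon
    simp only [mem_iUnion, not_exists, mem_ofPred_eq] at hcon
    have hx2 : ∀ j, f^[n] (f.symm^[j] x) ∉ B := by
      intro j hj
      exact hx (mem_iUnion.2 ⟨j, hj⟩)
    have hap : ∀ j, 1 ≤ j → f^[j] x ≠ x := by
      intro j hj
      have := hcon (j-1)
      rwa [Nat.sub_add_cancel hj] at this
    have hxB : x ∉ B := by have := hx2 n; rwa [hinv] at this
    obtain ⟨j, hj, h | h⟩ := hBc x hap hxB
    · apply hx2 (n - j)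
      have : n = j + (n - j) := by omega
      rw [this, Function.iterate_add_apply]
      simpa [hinv] using h
    · apply hx2 (n + j)
      rw [Function.iterate_add_apply, hinv]
      exact h
  refine ⟨L₀ ∪ Z, hL₀m.union hZm, ?_, ?_⟩
  · calc μ (L₀ ∪ Z) ≤ μ L₀ + μ Z := measure_union_le _ _
      _ = μ B := by rw [hZ0, add_zero, (hmp n).measure_preimage hBm.nullMeasurableSet]
      _ < ε := hBμ.trans_lt hn
  · intro x
    by_cases hx : x ∈ Z
    · exact ⟨0, Or.inr hx⟩
    · simp only [Z, mem_compl_iff, not_not, mem_iUnion] at hx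
      obtain ⟨j, hj⟩ := hx
      exact ⟨j, Or.inl hj⟩

noncomputable def halmosE {X : Type*} [MeasurableSpace X] {μ : Measure X}
    (A : ℕ → Set X) (S T : Aut X μ) : ENNReal :=
  ∑' i : ℕ, (2⁻¹ : ENNReal) ^ i *
    (μ (symmDiff (S.toEquiv '' A i) (T.toEquiv '' A i)) +
     μ (symmDiff (S.toEquiv.symm '' A i) (T.toEquiv.symm '' A i)))

lemma geomE : ∑' i : ℕ, (2⁻¹ : ENNReal) ^ i = 2 := by
  rw [ENNReal.tsum_geometric, ENNReal.one_sub_inv_two, inv_inv]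

lemma halmosE_le {X : Type*} [MeasurableSpace X] {μ : Measure X}
    (A : ℕ → Set X) (S T : Aut X μ) (c : ENNReal)
    (h : ∀ i, (μ (symmDiff (S.toEquiv '' A i) (T.toEquiv '' A i)) +
     μ (symmDiff (S.toEquiv.symm '' A i) (T.toEquiv.symm '' A i))) ≤ c) :
    halmosE A S T ≤ 2 * c := by
  unfold halmosE
  calc _ ≤ ∑' i : ℕ, (2⁻¹ : ENNReal) ^ i * c :=
        ENNReal.tsum_le_tsum fun i => by gcongr; exact h i
    _ = 2 * c := by rw [ENNReal.tsum_mul_right, geomE]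

lemma halmosE_ne_top {X : Type*} [MeasurableSpace X] {μ : Measure X} [IsProbabilityMeasure μ]
    (A : ℕ → Set X) (S T : Aut X μ) : halmosE A S T ≠ ⊤ := by
  have := halmosE_le A S T (1 + 1) (fun i => add_le_add prob_le_one prob_le_one)
  refine (this.trans_lt ?_).ne
  exact ENNReal.mul_lt_top (by simp) (by simp)

lemma halmos_eq {X : Type*} [MeasurableSpace X] {μ : Measure X} [IsProbabilityMeasure μ]
    (A : ℕ → Set X) (S T : Aut X μ) : halmos A S T = (halmosE A S T).toReal := by
  unfold halmos halmosE
  rw [ENNReal.tsum_toReal_eq]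
  · congr 1; ext i
    rw [ENNReal.toReal_mul, ENNReal.toReal_add (measure_ne_top _ _) (measure_ne_top _ _)]
    simp [ENNReal.toReal_pow]
  · intro i
    exact ENNReal.mul_ne_top (by simp) (by simp)

lemma halmos_lt_iff {X : Type*} [MeasurableSpace X] {μ : Measure X} [IsProbabilityMeasure μ]
    (A : ℕ → Set X) (S T : Aut X μ) (r : ℝ) :
    halmos A S T < r ↔ halmosE A S T < ENNReal.ofReal r := by
  rw [halmos_eq, ENNReal.lt_ofReal_iff_toReal_lt (halmosE_ne_top _ _ _)]

lemma halmosE_triangle {X : Type*} [MeasurableSpace X] {μ : Measure X}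
    (A : ℕ → Set X) (S T R : Aut X μ) : halmosE A S R ≤ halmosE A S T + halmosE A T R := by
  unfold halmosE
  rw [← ENNReal.tsum_add]
  refine ENNReal.tsum_le_tsum fun i => ?_
  rw [← mul_add]
  refine mul_le_mul_right ?_ _
  calc _ ≤ (μ (symmDiff (S.toEquiv '' A i) (T.toEquiv '' A i)) +
          μ (symmDiff (T.toEquiv '' A i) (R.toEquiv '' A i))) +
        (μ (symmDiff (S.toEquiv.symm '' A i) (T.toEquiv.symm '' A i)) +
          μ (symmDiff (T.toEquiv.symm '' A i) (R.toEquiv.symm '' A i))) :=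
        add_le_add (measure_symmDiff_le _ _ _) (measure_symmDiff_le _ _ _)
    _ = _ := by ring

lemma halmosE_comm {X : Type*} [MeasurableSpace X] {μ : Measure X}
    (A : ℕ → Set X) (S T : Aut X μ) : halmosE A S T = halmosE A T S := by
  unfold halmosE; simp only [symmDiff_comm]

lemma halmosE_inv {X : Type*} [MeasurableSpace X] {μ : Measure X}
    (A : ℕ → Set X) (S T : Aut X μ) : halmosE A S.inv T.inv = halmosE A S T := by
  unfold halmosE
  refine tsum_congr fun i => ?_
  rw [add_comm]; rfl

lemma Aut.measure_image {X : Type*} [MeasurableSpace X] {μ : Measure X} (S : Aut X μ)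
    (B : Set X) : μ (S.toEquiv '' B) = μ B := by
  rw [MeasurableEquiv.image_eq_preimage_symm]
  exact S.inv.mp.measure_preimage_equiv B

lemma image_symmDiff_aut {X : Type*} [MeasurableSpace X] {μ : Measure X} (S : Aut X μ)
    (B C : Set X) : μ (symmDiff (S.toEquiv '' B) (S.toEquiv '' C)) = μ (symmDiff B C) := by
  rw [← Set.image_symmDiff S.toEquiv.injective, S.measure_image]

open Filter Topology in
lemma tsum_tendsto_zero {ι : Type*} {l : Filter ι} (a : ι → ℕ → ENNReal) (ha : ∀ x k, a x k ≤ 2)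
    (h : ∀ k, Tendsto (fun x => a x k) l (𝓝 0)) :
    Tendsto (fun x => ∑' k, (2⁻¹ : ENNReal) ^ k * a x k) l (𝓝 0) := by
  have hat : ∀ x k, a x k ≠ ⊤ := fun x k => ((ha x k).trans_lt (by simp)).ne
  have key : Tendsto (fun x => ∑' k, ((1/2 : ℝ)) ^ k * (a x k).toReal) l (𝓝 (∑' k : ℕ, (0:ℝ))) := by
    refine tendsto_tsum_of_dominated_convergence (bound := fun k => (1/2 : ℝ)^k * 2) ?_ ?_ ?_
    · exact summable_geometric_two.mul_right 2
    · intro k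
      have := (ENNReal.tendsto_toReal ENNReal.zero_ne_top).comp (h k)
      simpa using this.const_mul ((1/2 : ℝ)^k)
    · refine Eventually.of_forall fun x k => ?_
      rw [Real.norm_of_nonneg (by positivity)]
      gcongr
      exact ENNReal.toReal_le_of_le_ofReal (by norm_num) (by simpa using ha x k)
  rw [tsum_zero] at key
  have h2 := ENNReal.tendsto_ofReal key
  rw [ENNReal.ofReal_zero] at h2
  refine h2.congr fun x => ?_
  have : ∑' k, ((1/2 : ℝ)) ^ k * (a x k).toReal = (∑' k, (2⁻¹ : ENNReal) ^ k * a x k).toReal := by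
    rw [ENNReal.tsum_toReal_eq]
    · simp [ENNReal.toReal_mul, ENNReal.toReal_pow]
    · intro k; exact ENNReal.mul_ne_top (by simp) (hat x k)
  rw [this, ENNReal.ofReal_toReal]
  have : ∑' k, (2⁻¹ : ENNReal) ^ k * a x k ≤ 2 * 2 := by
    calc _ ≤ ∑' k : ℕ, (2⁻¹ : ENNReal) ^ k * 2 := ENNReal.tsum_le_tsum fun k => by
            gcongr; exact ha x k
      _ = _ := by rw [ENNReal.tsum_mul_right, geomE]
  exact (this.trans_lt (ENNReal.mul_lt_top (by simp) (by simp))).ne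

open Filter Topology in
lemma conv_one {Z : Type*} [MeasurableSpace Z] {ν : Measure Z}
    (A : ℕ → Set Z) (hAd : ∀ B : Set Z, MeasurableSet B → ∀ ε > (0 : ℝ),
      ∃ i, ν (symmDiff B (A i)) < ENNReal.ofReal ε)
    {ι : Type*} {l : Filter ι} (E : Aut Z ν) (F : ι → Aut Z ν)
    (h : Tendsto (fun i => halmosE A E (F i)) l (𝓝 0)) (B : Set Z) (hB : MeasurableSet B) :
    Tendsto (fun i => ν (symmDiff (E.toEquiv '' B) ((F i).toEquiv '' B))) l (𝓝 0) := by
  rw [ENNReal.tendsto_nhds_zero]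
  intro ε hε
  obtain ⟨r, hr0, hr⟩ := ENNReal.lt_iff_exists_nnreal_btwn.1 (ENNReal.div_pos hε.ne' (by simp : (3:ENNReal) ≠ ⊤))
  obtain ⟨k, hk⟩ := hAd B hB r (by exact_mod_cast hr0)
  rw [ENNReal.ofReal_coe_nnreal] at hk
  have hk' := (hk.trans hr).le
  have h2 : Tendsto (fun i => (2:ENNReal)^k * halmosE A E (F i)) l (𝓝 0) := by
    simpa using ENNReal.Tendsto.const_mul h (Or.inr (by simp : (2:ENNReal)^k ≠ ⊤))
  have h3 := (ENNReal.tendsto_nhds_zero.1 h2) (ε/3) (ENNReal.div_pos hε.ne' (by simp))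
  filter_upwards [h3] with i hi
  have h4 : ν (symmDiff (E.toEquiv '' A k) ((F i).toEquiv '' A k)) ≤ 2^k * halmosE A E (F i) := by
    have := ENNReal.le_tsum (f := fun k => (2⁻¹ : ENNReal) ^ k *
      (ν (symmDiff (E.toEquiv '' A k) ((F i).toEquiv '' A k)) +
      ν (symmDiff (E.toEquiv.symm '' A k) ((F i).toEquiv.symm '' A k)))) k
    calc _ ≤ _ := le_self_add
      _ = 2^k * ((2⁻¹ : ENNReal) ^ k * (ν (symmDiff (E.toEquiv '' A k) ((F i).toEquiv '' A k)) +
      ν (symmDiff (E.toEquiv.symm '' A k) ((F i).toEquiv.symm '' A k)))) := by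
        rw [← mul_assoc, ← mul_pow, ENNReal.mul_inv_cancel (by simp) (by simp), one_pow, one_mul]
      _ ≤ _ := by gcongr; exact this
  calc ν (symmDiff (E.toEquiv '' B) ((F i).toEquiv '' B))
      ≤ ν (symmDiff (E.toEquiv '' B) (E.toEquiv '' A k)) +
        (ν (symmDiff (E.toEquiv '' A k) ((F i).toEquiv '' A k)) +
        ν (symmDiff ((F i).toEquiv '' A k) ((F i).toEquiv '' B))) :=
        (measure_symmDiff_le _ _ _).trans (add_le_add le_rfl (measure_symmDiff_le _ _ _))
    _ ≤ ε/3 + (ε/3 + ε/3) := by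
        rw [image_symmDiff_aut, image_symmDiff_aut, symmDiff_comm (A k) B]
        exact add_le_add hk' (add_le_add (h4.trans hi) hk')
    _ = ε := by rw [← add_assoc, ENNReal.add_thirds]

lemma measurableSet_image_iter {Z : Type*} [MeasurableSpace Z] (f : Z ≃ᵐ Z) (n : ℕ)
    {B : Set Z} (hB : MeasurableSet B) : MeasurableSet (f^[n] '' B) := by
  induction n with
  | zero => simpa using hB
  | succ n ih =>
    rw [Function.iterate_succ', Set.image_comp]
    exact f.measurableSet_image.2 ih

open Filter Topology in
lemma conv_pow {Z : Type*} [MeasurableSpace Z] {ν : Measure Z}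
    (A : ℕ → Set Z) (hAd : ∀ B : Set Z, MeasurableSet B → ∀ ε > (0 : ℝ),
      ∃ i, ν (symmDiff B (A i)) < ENNReal.ofReal ε)
    {ι : Type*} {l : Filter ι} (E : Aut Z ν) (F : ι → Aut Z ν)
    (h : Tendsto (fun i => halmosE A E (F i)) l (𝓝 0)) (B : Set Z) (hB : MeasurableSet B) (n : ℕ) :
    Tendsto (fun i => ν (symmDiff (E.toEquiv^[n] '' B) ((F i).toEquiv^[n] '' B))) l (𝓝 0) := by
  induction n with
  | zero => simpa using tendsto_const_nhds
  | succ n ih =>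
    have h1 := conv_one A hAd E F h (E.toEquiv^[n] '' B) (measurableSet_image_iter _ n hB)
    have h2 := h1.add ih
    rw [add_zero] at h2
    refine tendsto_of_tendsto_of_tendsto_of_le_of_le tendsto_const_nhds h2 (fun _ => zero_le) ?_
    intro i
    simp only [Function.iterate_succ', Set.image_comp]
    refine (measure_symmDiff_le _ ((F i).toEquiv '' (E.toEquiv^[n] '' B)) _).trans ?_
    rw [image_symmDiff_aut]

lemma SkewExt.iter {X : Type*} [MeasurableSpace X] {μ : Measure X} {S : Aut X μ}
    (E : SkewExt S) (n : ℕ) (x y : X) :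
    E.prod.toEquiv^[n] (x, y) = (S.toEquiv^[n] x, (cocycle S E.T x n).toEquiv y) := by
  induction n with
  | zero => rfl
  | succ n ih =>
    rw [Function.iterate_succ_apply', ih, E.spec, Function.iterate_succ_apply']
    rfl

lemma image_symm_iter {Z : Type*} [MeasurableSpace Z] (f : Z ≃ᵐ Z) (n : ℕ) (K : Set Z) :
    f.symm^[n] '' K = f^[n] ⁻¹' K :=
  congrFun (Set.image_eq_preimage_of_inverse
    (Function.LeftInverse.iterate f.apply_symm_apply n)
    (Function.LeftInverse.iterate f.symm_apply_apply n)) K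

lemma section_symm {X : Type*} [MeasurableSpace X] {μ : Measure X} {S : Aut X μ}
    (E : SkewExt S) (n : ℕ) (x : X) (K : Set X) :
    (cocycle S E.T x n).toEquiv.symm '' K =
      Prod.mk x ⁻¹' (E.prod.toEquiv.symm^[n] '' (univ ×ˢ K)) := by
  rw [image_symm_iter, MeasurableEquiv.image_eq_preimage_symm, MeasurableEquiv.symm_symm]
  ext y
  simp [E.iter]

lemma section_fwd {X : Type*} [MeasurableSpace X] {μ : Measure X} {S : Aut X μ}
    (E : SkewExt S) (n : ℕ) (x : X) (K : Set X) :
    (cocycle S E.T x n).toEquiv '' K =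
      Prod.mk (S.toEquiv^[n] x) ⁻¹' (E.prod.toEquiv^[n] '' (univ ×ˢ K)) := by
  ext y
  constructor
  · rintro ⟨z, hz, rfl⟩
    exact ⟨(x, z), ⟨mem_univ _, hz⟩, E.iter n x z⟩
  · rintro ⟨⟨x', z⟩, hz, h⟩
    rw [E.iter, Prod.mk.injEq] at h
    have : x' = x := (S.toEquiv.injective.iterate n) h.1
    subst this
    exact ⟨z, hz.2, h.2⟩

lemma integral_halmosE {X : Type*} [MeasurableSpace X] {μ : Measure X} [IsProbabilityMeasure μ]
    {S : Aut X μ} (A : ℕ → Set X) (hAm : ∀ i, MeasurableSet (A i)) (E F : SkewExt S) (n : ℕ) :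
    Measurable (fun x => halmosE A (cocycle S E.T x n) (cocycle S F.T x n)) ∧
    ∫⁻ x, halmosE A (cocycle S E.T x n) (cocycle S F.T x n) ∂μ =
      ∑' i : ℕ, (2⁻¹ : ENNReal) ^ i *
        ((μ.prod μ) (symmDiff (E.prod.toEquiv^[n] '' (univ ×ˢ A i))
            (F.prod.toEquiv^[n] '' (univ ×ˢ A i))) +
         (μ.prod μ) (symmDiff (E.prod.toEquiv.symm^[n] '' (univ ×ˢ A i))
            (F.prod.toEquiv.symm^[n] '' (univ ×ˢ A i)))) := by
  have hK : ∀ i, MeasurableSet ((univ : Set X) ×ˢ A i) := fun i => MeasurableSet.univ.prod (hAm i)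
  have hP : ∀ i, MeasurableSet (symmDiff (E.prod.toEquiv^[n] '' (univ ×ˢ A i))
            (F.prod.toEquiv^[n] '' (univ ×ˢ A i))) := fun i =>
    (measurableSet_image_iter _ n (hK i)).symmDiff (measurableSet_image_iter _ n (hK i))
  have hQ : ∀ i, MeasurableSet (symmDiff (E.prod.toEquiv.symm^[n] '' (univ ×ˢ A i))
            (F.prod.toEquiv.symm^[n] '' (univ ×ˢ A i))) := fun i =>
    (measurableSet_image_iter _ n (hK i)).symmDiff (measurableSet_image_iter _ n (hK i))
  have hSm : MeasurePreserving (S.toEquiv^[n]) μ μ := S.mp.iterate n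
  have m1 := fun i => (measurable_measure_prodMk_left (ν := μ) (hP i)).comp hSm.measurable
  have m2 := fun i => measurable_measure_prodMk_left (ν := μ) (hQ i)
  have hform : ∀ x, halmosE A (cocycle S E.T x n) (cocycle S F.T x n) =
      ∑' i : ℕ, (2⁻¹ : ENNReal) ^ i *
        (μ (Prod.mk (S.toEquiv^[n] x) ⁻¹' (symmDiff (E.prod.toEquiv^[n] '' (univ ×ˢ A i))
            (F.prod.toEquiv^[n] '' (univ ×ˢ A i)))) +
         μ (Prod.mk x ⁻¹' (symmDiff (E.prod.toEquiv.symm^[n] '' (univ ×ˢ A i))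
            (F.prod.toEquiv.symm^[n] '' (univ ×ˢ A i))))) := by
    intro x
    unfold halmosE
    refine tsum_congr fun i => ?_
    rw [section_symm, section_symm, section_fwd, section_fwd]
    rfl
  have m3 : ∀ i, Measurable (fun x => (2⁻¹ : ENNReal) ^ i *
        (μ (Prod.mk (S.toEquiv^[n] x) ⁻¹' (symmDiff (E.prod.toEquiv^[n] '' (univ ×ˢ A i))
            (F.prod.toEquiv^[n] '' (univ ×ˢ A i)))) +
         μ (Prod.mk x ⁻¹' (symmDiff (E.prod.toEquiv.symm^[n] '' (univ ×ˢ A i))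
            (F.prod.toEquiv.symm^[n] '' (univ ×ˢ A i)))))) := fun i =>
    ((m1 i).add (m2 i)).const_mul _
  simp only [hform]
  refine ⟨Measurable.tsum m3, ?_⟩
  rw [lintegral_tsum fun i => (m3 i).aemeasurable]
  refine tsum_congr fun i => ?_
  rw [lintegral_const_mul _ (by exact (m1 i).add (m2 i)), lintegral_add_left (by exact m1 i),
    Measure.prod_apply (hP i), Measure.prod_apply (hQ i),
    ← hSm.lintegral_comp (measurable_measure_prodMk_left (ν := μ) (hP i))]

open Filter Topology in
lemma integral_tendsto {X : Type*} [MeasurableSpace X] {μ : Measure X} [IsProbabilityMeasure μ]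
    {S : Aut X μ} (A : ℕ → Set X) (hAm : ∀ i, MeasurableSet (A i))
    (A₂ : ℕ → Set (X × X))
    (hA₂d : ∀ B : Set (X × X), MeasurableSet B → ∀ ε > (0 : ℝ),
      ∃ i, (μ.prod μ) (symmDiff B (A₂ i)) < ENNReal.ofReal ε)
    (E : SkewExt S) (n : ℕ) (l : Filter (SkewExt S))
    (h : Tendsto (fun F : SkewExt S => halmosE A₂ E.prod F.prod) l (𝓝 0)) :
    Tendsto (fun F : SkewExt S =>
      ∫⁻ x, halmosE A (cocycle S E.T x n) (cocycle S F.T x n) ∂μ) l (𝓝 0) := by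
  have hK : ∀ i, MeasurableSet ((univ : Set X) ×ˢ A i) := fun i => MeasurableSet.univ.prod (hAm i)
  simp only [fun F => (integral_halmosE A hAm E F n).2]
  refine tsum_tendsto_zero _ (fun F i => ?_) (fun i => ?_)
  · rw [← one_add_one_eq_two]
    exact add_le_add prob_le_one prob_le_one
  · have h1 := conv_pow A₂ hA₂d E.prod (fun F : SkewExt S => F.prod) h _ (hK i) n
    have h2 := conv_pow A₂ hA₂d E.prod.inv (fun F : SkewExt S => F.prod.inv)
      (by simpa only [halmosE_inv] using h) _ (hK i) n
    have h3 := h1.add h2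
    rw [add_zero] at h3
    exact h3

open Filter Topology in
lemma rec_open {X : Type*} [MeasurableSpace X] {μ : Measure X} [IsProbabilityMeasure μ]
    {S : Aut X μ} (A : ℕ → Set X) (hAm : ∀ i, MeasurableSet (A i))
    (A₂ : ℕ → Set (X × X))
    (hA₂d : ∀ B : Set (X × X), MeasurableSet B → ∀ ε > (0 : ℝ),
      ∃ i, (μ.prod μ) (symmDiff B (A₂ i)) < ENNReal.ofReal ε)
    (C : Set X) (r : ℝ) (N : ℕ) :
    IsOpenWrt (fun E F : SkewExt S => halmos A₂ E.prod F.prod)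
      {E : SkewExt S | ∃ n > N, 0 < μ {x : X | x ∈ C ∧ halmos A (cocycle S E.T x n) (Aut.id μ) < r}} := by
  rintro E ⟨n, hn, hpos⟩
  obtain ⟨η, hη, hW⟩ : ∃ η : ENNReal, 0 < η ∧
      0 < μ {x | x ∈ C ∧ η + halmosE A (cocycle S E.T x n) (Aut.id μ) < ENNReal.ofReal r} := by
    by_contra hcon
    push Not at hcon
    refine hpos.ne' (measure_mono_null (t := ⋃ j : ℕ, {x | x ∈ C ∧ ((j + 1 : ℕ) : ENNReal)⁻¹ +
      halmosE A (cocycle S E.T x n) (Aut.id μ) < ENNReal.ofReal r}) ?_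
      (measure_iUnion_null fun j => le_antisymm (hcon _ (by simp)) zero_le))
    rintro x ⟨hx, hlt⟩
    rw [halmos_lt_iff] at hlt
    obtain ⟨j, hj⟩ := ENNReal.exists_inv_nat_lt (tsub_pos_of_lt hlt).ne'
    refine mem_iUnion.2 ⟨j, hx, ?_⟩
    refine lt_tsub_iff_right.1 (lt_of_le_of_lt ?_ hj)
    gcongr
    simp
  let l : Filter (SkewExt S) := comap (fun F => halmosE A₂ E.prod F.prod) (𝓝 0)
  have ht := integral_tendsto A hAm A₂ hA₂d E n l tendsto_comap
  have hev := ht.eventually_lt_const (ENNReal.mul_pos hη.ne' hW.ne')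
  have hb : (𝓝 (0:ENNReal)).HasBasis (fun ε => 0 < ε) (fun ε => Iio ε) := by
    simpa using ENNReal.nhds_zero_basis
  obtain ⟨ε, hε, hsub⟩ := (hb.comap (fun F : SkewExt S => halmosE A₂ E.prod F.prod)).eventually_iff.1 hev
  obtain ⟨q, hq0, hq⟩ := ENNReal.lt_iff_exists_nnreal_btwn.1 hε
  refine ⟨q, by exact_mod_cast hq0, fun F hF => ⟨n, hn, ?_⟩⟩
  have hF2 := (halmos_lt_iff _ _ _ _).1 hF
  rw [ENNReal.ofReal_coe_nnreal] at hF2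
  have hint := @hsub F (hF2.trans hq)
  by_contra hnot
  have hzero := nonpos_iff_eq_zero.1 (not_lt.1 hnot)
  refine hint.not_ge ?_
  refine le_trans ?_ (mul_meas_ge_le_lintegral₀
    (integral_halmosE A hAm E F n).1.aemeasurable η)
  refine mul_le_mul_right ?_ _
  refine measure_mono_ae ?_
  have : ∀ᵐ x ∂μ, ¬ (x ∈ C ∧ halmos A (cocycle S F.T x n) (Aut.id μ) < r) := by
    rw [ae_iff]; simpa using hzero
  filter_upwards [this] with x hx hxW
  obtain ⟨hxC, hxl⟩ := hxW
  have h1 : ENNReal.ofReal r ≤ halmosE A (cocycle S F.T x n) (Aut.id μ) := by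
    by_contra h
    exact hx ⟨hxC, (halmos_lt_iff _ _ _ _).2 (not_le.1 h)⟩
  have h2 := halmosE_triangle A (cocycle S F.T x n) (cocycle S E.T x n) (Aut.id μ)
  rw [halmosE_comm A (cocycle S F.T x n) (cocycle S E.T x n)] at h2
  have h3 := (hxl.trans_le (h1.trans h2)).le
  exact (ENNReal.add_le_add_iff_right (halmosE_ne_top _ _ _)).1 h3

lemma Aut.ext' {X : Type*} [MeasurableSpace X] {μ : Measure X} {a b : Aut X μ}
    (h : ∀ x, a.toEquiv x = b.toEquiv x) : a = b := by
  cases a; cases b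
  simp only [Aut.mk.injEq]
  exact MeasurableEquiv.ext (funext h)

/-- The coboundary extension attached to a measurable family `φ`. -/
noncomputable def cob {X : Type*} [MeasurableSpace X] {μ : Measure X} [SFinite μ] (S : Aut X μ)
    (φ : X → Aut X μ) (Φ : Aut (X × X) (μ.prod μ))
    (h : ∀ p : X × X, Φ.toEquiv p = (p.1, (φ p.1).toEquiv p.2)) : SkewExt S where
  T x := (φ (S.toEquiv x)).comp (φ x).inv
  prod := Φ.comp ((prodId S).comp Φ.inv)
  spec := by
    rintro ⟨x, y⟩
    have h1 : Φ.toEquiv.symm (x, y) = (x, (φ x).toEquiv.symm y) := by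
      rw [MeasurableEquiv.symm_apply_eq, h]
      simp
    change Φ.toEquiv ((prodId S).toEquiv (Φ.toEquiv.symm (x, y))) = _
    rw [h1, h]
    rfl

lemma cob_cocycle {X : Type*} [MeasurableSpace X] {μ : Measure X} [SFinite μ] (S : Aut X μ)
    (φ : X → Aut X μ) (Φ : Aut (X × X) (μ.prod μ))
    (h : ∀ p : X × X, Φ.toEquiv p = (p.1, (φ p.1).toEquiv p.2)) (x : X) (n : ℕ) :
    cocycle S (cob S φ Φ h).T x n = (φ (S.toEquiv^[n] x)).comp (φ x).inv := by
  induction n with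
  | zero =>
    refine Aut.ext' fun y => ?_
    change y = (φ x).toEquiv ((φ x).toEquiv.symm y)
    simp
  | succ n ih =>
    refine Aut.ext' fun y => ?_
    rw [cocycle, ih, Function.iterate_succ_apply']
    change (φ (S.toEquiv (S.toEquiv^[n] x))).toEquiv ((φ (S.toEquiv^[n] x)).toEquiv.symm
      ((φ (S.toEquiv^[n] x)).toEquiv ((φ x).toEquiv.symm y))) = _
    rw [MeasurableEquiv.symm_apply_apply]
    rfl

lemma halmosE_comp_inv {X : Type*} [MeasurableSpace X] {μ : Measure X}
    (A : ℕ → Set X) (a b : Aut X μ) :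
    halmosE A (a.comp b.inv) (Aut.id μ) = ∑' i : ℕ, (2⁻¹ : ENNReal) ^ i *
      (μ (symmDiff (a.toEquiv.symm '' A i) (b.toEquiv.symm '' A i)) +
       μ (symmDiff (a.toEquiv.symm '' A i) (b.toEquiv.symm '' A i))) := by
  have key : ∀ (a b : Aut X μ) (K : Set X), μ (symmDiff ((a.comp b.inv).toEquiv '' K) K) =
      μ (symmDiff (a.toEquiv.symm '' K) (b.toEquiv.symm '' K)) := by
    intro a b K
    have h1 : (a.comp b.inv).toEquiv '' K = a.toEquiv '' (b.toEquiv.symm '' K) := by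
      rw [← Set.image_comp]; rfl
    have h2 : K = a.toEquiv '' (a.toEquiv.symm '' K) := by
      rw [← Set.image_comp]; simp
    rw [h1]
    nth_rewrite 2 [h2]
    rw [image_symmDiff_aut, symmDiff_comm]
  unfold halmosE
  refine tsum_congr fun i => ?_
  congr 2
  · have := key a b (A i)
    rw [← this]
    congr 2
    exact Set.image_id _
  · have := key b a (A i)
    rw [symmDiff_comm (a.toEquiv.symm '' A i), ← this]
    congr 2
    exact Set.image_id _

open Filter Topology in
lemma rec_cob {X : Type*} [MeasurableSpace X] {μ : Measure X} [IsProbabilityMeasure μ]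
    (S : Aut X μ) (A : ℕ → Set X) (hAm : ∀ i, MeasurableSet (A i))
    (hAd : ∀ B : Set X, MeasurableSet B → ∀ ε > (0 : ℝ),
      ∃ i, μ (symmDiff B (A i)) < ENNReal.ofReal ε)
    (φ : X → Aut X μ) (Φ : Aut (X × X) (μ.prod μ))
    (h : ∀ p : X × X, Φ.toEquiv p = (p.1, (φ p.1).toEquiv p.2))
    (C : Set X) (hC : MeasurableSet C) (hC0 : 0 < μ C) (r : ℝ) (hr : 0 < r) (N : ℕ) :
    ∃ n > N, 0 < μ {x : X | x ∈ C ∧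
      halmos A (cocycle S (cob S φ Φ h).T x n) (Aut.id μ) < r} := by
  let κ : ℕ → ENNReal := fun I => (I : ENNReal)⁻¹
  let a : ℕ → ℕ → ENNReal := fun I i => if i < I then min 2 (4 * κ I) else 2
  have hκ : Tendsto κ atTop (𝓝 0) := ENNReal.tendsto_inv_nat_nhds_zero
  have ha : Tendsto (fun I => ∑' k, (2⁻¹ : ENNReal) ^ k * a I k) atTop (𝓝 0) := by
    refine tsum_tendsto_zero a (fun I i => ?_) (fun i => ?_)
    · simp only [a]; split_ifs
      · exact min_le_left _ _
      · exact le_rfl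
    · have h4 : Tendsto (fun I => 4 * κ I) atTop (𝓝 0) := by
        simpa using ENNReal.Tendsto.const_mul hκ (Or.inr (by simp : (4:ENNReal) ≠ ⊤))
      refine tendsto_of_tendsto_of_tendsto_of_le_of_le' tendsto_const_nhds h4
        (Eventually.of_forall fun _ => zero_le) ?_
      filter_upwards [eventually_gt_atTop i] with I hI
      simp only [a, if_pos hI]
      exact min_le_right _ _
  obtain ⟨I, hI⟩ := (ha.eventually_lt_const (ENNReal.ofReal_pos.2 hr)).exists
  have hsec : ∀ x i, (φ x).toEquiv.symm '' A i = Prod.mk x ⁻¹' (Φ.toEquiv ⁻¹' (univ ×ˢ A i)) := by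
    intro x i
    rw [MeasurableEquiv.image_eq_preimage_symm, MeasurableEquiv.symm_symm]
    ext y; simp [h]
  let P : (Fin I → ℕ) → Set X := fun f =>
    C ∩ ⋂ i : Fin I, {x | μ (symmDiff ((φ x).toEquiv.symm '' A i) (A (f i))) < κ I}
  have hPm : ∀ f, MeasurableSet (P f) := by
    intro f
    refine hC.inter (MeasurableSet.iInter fun i => ?_)
    have hm : MeasurableSet (symmDiff (Φ.toEquiv ⁻¹' (univ ×ˢ A i)) (univ ×ˢ A (f i))) :=
      (Φ.toEquiv.measurable (MeasurableSet.univ.prod (hAm i))).symmDiff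
        (MeasurableSet.univ.prod (hAm (f i)))
    have hm2 := measurable_measure_prodMk_left (ν := μ) hm
    have := measurableSet_lt hm2 (measurable_const (a := κ I))
    convert this using 5 with x
    rw [hsec]
    ext y; simp [Set.mem_symmDiff]
  have hcov : C ⊆ ⋃ f, P f := by
    intro x hx
    have hκ0 : 0 < κ I := by simp [κ]
    obtain ⟨q, hq0, hq⟩ := ENNReal.lt_iff_exists_nnreal_btwn.1 hκ0
    have : ∀ i : Fin I, ∃ l, μ (symmDiff ((φ x).toEquiv.symm '' A i) (A l)) < κ I := by
      intro i
      obtain ⟨l, hl⟩ := hAd ((φ x).toEquiv.symm '' A i)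
        ((MeasurableEquiv.measurableSet_image _).2 (hAm i)) q (by exact_mod_cast hq0)
      rw [ENNReal.ofReal_coe_nnreal] at hl
      exact ⟨l, hl.trans hq⟩
    choose f hf using this
    exact mem_iUnion.2 ⟨f, hx, mem_iInter.2 hf⟩
  obtain ⟨f, hf⟩ : ∃ f, μ (P f) ≠ 0 := by
    by_contra hcon
    push Not at hcon
    exact hC0.ne' (measure_mono_null hcov (measure_iUnion_null hcon))
  obtain ⟨n, hn, hpos⟩ := S.mp.conservative.exists_gt_measure_inter_ne_zero
    (hPm f).nullMeasurableSet hf N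
  refine ⟨n, hn, (pos_iff_ne_zero.2 hpos).trans_le (measure_mono ?_)⟩
  rintro x ⟨hx, hx'⟩
  refine ⟨hx.1, ?_⟩
  rw [halmos_lt_iff, cob_cocycle, halmosE_comp_inv]
  refine lt_of_le_of_lt (ENNReal.tsum_le_tsum fun i => ?_) hI
  refine mul_le_mul_right ?_ _
  have h2 : ∀ s t : Set X, μ s + μ t ≤ 2 := fun s t => by
    rw [← one_add_one_eq_two]; exact add_le_add prob_le_one prob_le_one
  simp only [a]
  split_ifs with hi
  · refine le_min (h2 _ _) ?_
    have e1 : μ (symmDiff ((φ x).toEquiv.symm '' A i) (A (f ⟨i, hi⟩))) < κ I :=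
      mem_iInter.1 hx.2 ⟨i, hi⟩
    have e2 : μ (symmDiff ((φ (S.toEquiv^[n] x)).toEquiv.symm '' A i) (A (f ⟨i, hi⟩))) < κ I :=
      mem_iInter.1 hx'.2 ⟨i, hi⟩
    rw [symmDiff_comm] at e1
    have e3 := (measure_symmDiff_le (μ := μ) ((φ (S.toEquiv^[n] x)).toEquiv.symm '' A i)
      (A (f ⟨i, hi⟩)) ((φ x).toEquiv.symm '' A i)).trans (add_le_add e2.le e1.le)
    calc _ ≤ _ := add_le_add e3 e3
      _ = 4 * κ I := by ring
  · exact h2 _ _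

lemma cob_dense {X : Type*} [MeasurableSpace X] [StandardBorelSpace X]
    {μ : Measure X} [IsProbabilityMeasure μ] (S : Aut X μ) (hS : Aperiodic S)
    (A₂ : ℕ → Set (X × X)) (E : SkewExt S) (ε : ℝ) (hε : 0 < ε) :
    ∃ (φ : X → Aut X μ) (Φ : Aut (X × X) (μ.prod μ))
      (h : ∀ p : X × X, Φ.toEquiv p = (p.1, (φ p.1).toEquiv p.2)),
      halmos A₂ E.prod (cob S φ Φ h).prod < ε := by
  classical
  obtain ⟨L, hLm, hLμ, hL⟩ := marker S hS (ENNReal.ofReal ε / 6)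
    (ENNReal.div_pos (ENNReal.ofReal_pos.2 hε).ne' (by simp))
  set f := S.toEquiv with hf
  let j : X → ℕ := fun x => Nat.find (hL x)
  have hjm : Measurable j := measurable_find hL
    (fun k => (f.symm.measurable.iterate k) hLm)
  let φ : X → Aut X μ := fun x => cocycle S E.T (f.symm^[j x] x) (j x)
  have hinv : ∀ j x, f^[j] (f.symm^[j] x) = x := fun j =>
    (Function.LeftInverse.iterate f.apply_symm_apply j)
  have hpairm : Measurable (fun p : X × X => (j p.1, p)) :=
    (hjm.comp measurable_fst).prodMk measurable_id
  have hm1 : Measurable (fun p : X × X => (φ p.1).toEquiv p.2) := by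
    have : Measurable (fun q : ℕ × (X × X) =>
        (E.prod.toEquiv^[q.1] (f.symm^[q.1] q.2.1, q.2.2)).2) :=
      measurable_from_prod_countable_right fun n =>
        measurable_snd.comp ((E.prod.toEquiv.measurable.iterate n).comp
          (((f.symm.measurable.iterate n).comp measurable_fst).prodMk measurable_snd))
    convert this.comp hpairm using 1
    ext p
    simp [E.iter, φ]
  have hm2 : Measurable (fun p : X × X => (φ p.1).toEquiv.symm p.2) := by
    have : Measurable (fun q : ℕ × (X × X) => (E.prod.toEquiv.symm^[q.1] q.2).2) :=
      measurable_from_prod_countable_right fun n =>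
        measurable_snd.comp (E.prod.toEquiv.symm.measurable.iterate n)
    convert this.comp hpairm using 1
    ext p
    have h1 : E.prod.toEquiv^[j p.1] (f.symm^[j p.1] p.1, (φ p.1).toEquiv.symm p.2) = p := by
      rw [E.iter]
      change (f^[j p.1] _, (φ p.1).toEquiv _) = p
      rw [hinv, MeasurableEquiv.apply_symm_apply]
    have h2 : E.prod.toEquiv.symm^[j p.1] p = (f.symm^[j p.1] p.1, (φ p.1).toEquiv.symm p.2) := by
      have h3 := Function.LeftInverse.iterate E.prod.toEquiv.symm_apply_apply (j p.1)
        (f.symm^[j p.1] p.1, (φ p.1).toEquiv.symm p.2)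
      rw [h1] at h3
      exact h3
    simp [h2]
  let Φ : Aut (X × X) (μ.prod μ) :=
    { toEquiv :=
        { toFun := fun p => (p.1, (φ p.1).toEquiv p.2)
          invFun := fun p => (p.1, (φ p.1).toEquiv.symm p.2)
          left_inv := fun p => by simp
          right_inv := fun p => by simp
          measurable_toFun := measurable_fst.prodMk hm1
          measurable_invFun := measurable_fst.prodMk hm2 }
      mp := MeasurePreserving.skew_product (f := fun x => x) (g := fun x y => (φ x).toEquiv y)
        (MeasurePreserving.id μ) hm1 (Filter.Eventually.of_forall fun x => (φ x).mp.map_eq) }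
  have hΦ : ∀ p : X × X, Φ.toEquiv p = (p.1, (φ p.1).toEquiv p.2) := fun p => rfl
  refine ⟨φ, Φ, hΦ, ?_⟩
  set F := cob S φ Φ hΦ with hF
  let Q : Set (X × X) := (f ⁻¹' L) ×ˢ univ
  have hQμ : (μ.prod μ) Q = μ L := by
    rw [Measure.prod_prod, measure_univ, mul_one]
    exact S.mp.measure_preimage_equiv L
  have hφ : ∀ x, f x ∉ L → ∀ y, (φ (f x)).toEquiv y = (E.T x).toEquiv ((φ x).toEquiv y) := by
    intro x hx y
    have hj : j (f x) = j x + 1 := by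
      rw [Nat.find_eq_iff]
      constructor
      · rw [Function.iterate_succ_apply, f.symm_apply_apply]
        exact Nat.find_spec (hL x)
      · intro n hn
        rcases n with _ | n
        · exact hx
        · rw [Function.iterate_succ_apply, f.symm_apply_apply]
          exact Nat.find_min (hL x) (Nat.lt_of_succ_lt_succ hn)
    simp only [φ]
    rw [hj, Function.iterate_succ_apply, f.symm_apply_apply, cocycle]
    change (E.T (f^[j x] _)).toEquiv _ = _
    rw [hinv]
    rfl
  have hEF : ∀ p, p ∉ Q → E.prod.toEquiv p = F.prod.toEquiv p := by
    rintro ⟨x, y⟩ hp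
    have hx : f x ∉ L := fun h => hp ⟨h, mem_univ _⟩
    rw [E.spec, F.spec]
    congr 1
    change _ = (φ (f x)).toEquiv ((φ x).toEquiv.symm y)
    rw [hφ x hx, MeasurableEquiv.apply_symm_apply]
  rw [halmos_lt_iff]
  refine (halmosE_le A₂ E.prod F.prod (3 * μ L) fun i => ?_).trans_lt ?_
  · have h1 : (μ.prod μ) (symmDiff (E.prod.toEquiv '' A₂ i) (F.prod.toEquiv '' A₂ i)) ≤
        μ L + μ L := by
      have hs : symmDiff (E.prod.toEquiv '' A₂ i) (F.prod.toEquiv '' A₂ i) ⊆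
          E.prod.toEquiv '' Q ∪ F.prod.toEquiv '' Q := by
        rintro z (⟨⟨p, hp, rfl⟩, hz⟩ | ⟨⟨p, hp, rfl⟩, hz⟩)
        · left
          by_contra hcon
          have hpQ : p ∉ Q := fun h => hcon ⟨p, h, rfl⟩
          exact hz ⟨p, hp, (hEF p hpQ).symm⟩
        · right
          by_contra hcon
          have hpQ : p ∉ Q := fun h => hcon ⟨p, h, rfl⟩
          exact hz ⟨p, hp, hEF p hpQ⟩
      refine (measure_mono hs).trans ((measure_union_le _ _).trans ?_)
      rw [Aut.measure_image, Aut.measure_image, hQμ]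
    have h2 : (μ.prod μ) (symmDiff (E.prod.toEquiv.symm '' A₂ i) (F.prod.toEquiv.symm '' A₂ i)) ≤
        μ L := by
      rw [← hQμ]
      refine measure_mono ?_
      rw [MeasurableEquiv.image_eq_preimage_symm, MeasurableEquiv.image_eq_preimage_symm,
        MeasurableEquiv.symm_symm, MeasurableEquiv.symm_symm]
      intro p hp
      by_contra hcon
      have := hEF p hcon
      simp [Set.mem_symmDiff, this] at hp
    calc _ ≤ _ := add_le_add h1 h2
      _ = 3 * μ L := by ring
  · rw [← mul_assoc]
    norm_num
    rw [mul_comm]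
    exact (ENNReal.lt_div_iff_mul_lt (by simp) (by simp)).1 hLμ

/-- For aperiodic `S` and a countable algebra `𝒜` dense in the measure algebra,
recurrence on all `A ∈ 𝒜` of positive measure holds generically: the intersection
`⋂_(A ∈ 𝒜, μ(A)>0) Rec(S, A)` contains a dense `G_δ` subset of `Ext(S)`. -/
theorem rec_on_algebra_generic {X : Type*} [MeasurableSpace X] [StandardBorelSpace X]
    (μ : Measure X) [IsProbabilityMeasure μ] (S : Aut X μ)
    (hS : Aperiodic S)
    (A : ℕ → Set X) (hAm : ∀ i, MeasurableSet (A i))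
    (hAd : ∀ B : Set X, MeasurableSet B → ∀ ε > (0 : ℝ),
      ∃ i, μ (symmDiff B (A i)) < ENNReal.ofReal ε)
    (A₂ : ℕ → Set (X × X)) (hA₂m : ∀ i, MeasurableSet (A₂ i))
    (hA₂d : ∀ B : Set (X × X), MeasurableSet B → ∀ ε > (0 : ℝ),
      ∃ i, (μ.prod μ) (symmDiff B (A₂ i)) < ENNReal.ofReal ε)
    (𝒜 : ℕ → Set X) (h𝒜m : ∀ k, MeasurableSet (𝒜 k))
    (h𝒜c : ∀ i, ∃ k, 𝒜 k = (𝒜 i)ᶜ) (h𝒜u : ∀ i j, ∃ k, 𝒜 k = 𝒜 i ∪ 𝒜 j)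
    (h𝒜d : ∀ B : Set X, MeasurableSet B → ∀ ε > (0 : ℝ),
      ∃ k, μ (symmDiff B (𝒜 k)) < ENNReal.ofReal ε) :
    ∃ D : Set (SkewExt S),
      D ⊆ {E : SkewExt S | ∀ k : ℕ, 0 < μ (𝒜 k) →
        ∀ m : ℕ, 1 ≤ m → ∀ N : ℕ, ∃ n > N,
          0 < μ {x : X | x ∈ 𝒜 k ∧ halmos A (cocycle S E.T x n) (Aut.id μ) < 1 / m}} ∧
      IsGdeltaWrt (fun E F : SkewExt S => halmos A₂ E.prod F.prod) D ∧
      IsDenseWrt (fun E F : SkewExt S => halmos A₂ E.prod F.prod) D := by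
  refine ⟨⋂ q : ℕ × ℕ × ℕ, {E : SkewExt S | 0 < μ (𝒜 q.1) → 1 ≤ q.2.1 → ∃ n > q.2.2,
    0 < μ {x : X | x ∈ 𝒜 q.1 ∧ halmos A (cocycle S E.T x n) (Aut.id μ) < 1 / q.2.1}}, ?_, ?_, ?_⟩
  · intro E hE k hk m hm N
    exact mem_iInter.1 hE (k, m, N) hk hm
  · obtain ⟨e, he⟩ := exists_surjective_nat (ℕ × ℕ × ℕ)
    refine ⟨fun i => {E : SkewExt S | 0 < μ (𝒜 (e i).1) → 1 ≤ (e i).2.1 → ∃ n > (e i).2.2,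
      0 < μ {x : X | x ∈ 𝒜 (e i).1 ∧
        halmos A (cocycle S E.T x n) (Aut.id μ) < 1 / (e i).2.1}}, ?_, ?_⟩
    · intro i E hE
      by_cases h : 0 < μ (𝒜 (e i).1) ∧ 1 ≤ (e i).2.1
      · obtain ⟨ε, hε, hb⟩ := rec_open A hAm A₂ hA₂d (𝒜 (e i).1) (1 / ((e i).2.1 : ℝ)) (e i).2.2
          E (hE h.1 h.2)
        exact ⟨ε, hε, fun F hF _ _ => hb F hF⟩
      · exact ⟨1, one_pos, fun F _ h1 h2 => absurd ⟨h1, h2⟩ h⟩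
    · exact (he.iInter_comp _).symm
  · intro E ε hε
    obtain ⟨φ, Φ, h, hd⟩ := cob_dense S hS A₂ E ε hε
    refine ⟨cob S φ Φ h, mem_iInter.2 fun q hk hm => ?_, hd⟩
    exact rec_cob S A hAm hAd φ Φ h (𝒜 q.1) (h𝒜m _) hk _
      (one_div_pos.2 (by exact_mod_cast hm)) q.2.2
end
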